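/- The family ν satisfies the 2^{k−1}-correlation condition. -/

import Mathlib

open Finset Filter
open scoped Classical

noncomputable section

/-- `ε_k := 1/(2^k (k+4)!)`. -/
def epsk (k : ℕ) : ℝ := 1 / (2 ^ k * (Nat.factorial (k + 4)))

/-- `W(N) := ∏_{p ≤ w(N)} p`. -/
def Wprim (w : ℕ → ℕ) (N : ℕ) : ℕ := ∏ p ∈ (Finset.range (w N + 1)).filter Nat.Prime, p

/-- W-tricked von Mangoldt function. -/
def tildeLambda (W n : ℕ) : ℝ :=
  if Nat.Prime (W * n + 1) then (Nat.totient W : ℝ) / W * Real.log (W * n + 1) else 0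

/-- truncated divisor sum `Λ_R`. -/
def LambdaR (R : ℝ) (n : ℕ) : ℝ :=
  ∑ d ∈ n.divisors.filter (fun d : ℕ => (d : ℝ) ≤ R),
    ((ArithmeticFunction.moebius d : ℤ) : ℝ) * Real.log (R / (d : ℝ))

/-- the representative of `n : ZMod m` lying in `[N, N+m)`. -/
def reprN (N : ℕ) {m : ℕ} (n : ZMod m) : ℕ := N + (n - (N : ZMod m)).val

/-- the condition `ε_k M ≤ n - N ≤ 2 ε_k M` on the representative in `[N, N+m)`. -/
def inWindow (k N : ℕ) {m : ℕ} (n : ZMod m) : Prop :=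
  epsk k * m ≤ ((n - (N : ZMod m)).val : ℝ) ∧ ((n - (N : ZMod m)).val : ℝ) ≤ 2 * epsk k * m

/-- `R := M^(1/(k 2^(k+4)))`. -/
def Rpar (k m : ℕ) : ℝ := (m : ℝ) ^ ((1 : ℝ) / (k * 2 ^ (k + 4)))

/-- the Green–Tao majorant `ν`. -/
def nuGT (k N W : ℕ) {m : ℕ} (n : ZMod m) : ℝ :=
  if inWindow k N n then
    (Nat.totient W : ℝ) / W * (LambdaR (Rpar k m) (W * reprN N n + 1)) ^ 2 / Real.log (Rpar k m)
  else 1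

/-- the function `f`. -/
def fGT (k N W : ℕ) {m : ℕ} (n : ZMod m) : ℝ :=
  if inWindow k N n then tildeLambda W (reprN N n) / (k * 2 ^ (k + 5)) else 0

/-- the set of integers `n` with `ε_k M ≤ n - N ≤ 2 ε_k M`. -/
def windowSet (k N m : ℕ) : Finset ℕ :=
  (Finset.range (N + m + 1)).filter
    (fun n => epsk k * m ≤ (n : ℝ) - N ∧ (n : ℝ) - N ≤ 2 * epsk k * m)

/-- `E(Λ̃(n) | ε_k M ≤ n - N ≤ 2 ε_k M)`. -/
def avgWindow (k N m W : ℕ) : ℝ :=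
  (∑ n ∈ windowSet k N m, tildeLambda W n) / (windowSet k N m).card

/-- `E(g(x) | x ∈ Z_m)`. -/
def avgZ (m : ℕ) (g : ZMod m → ℝ) : ℝ := (∑ x ∈ Finset.range m, g (x : ZMod m)) / m

/-- `E(g(x) g(x+r) ⋯ g(x+(k-1)r) | x, r ∈ Z_m)`. -/
def apAvg (k m : ℕ) (g : ZMod m → ℝ) : ℝ :=
  (∑ x ∈ Finset.range m, ∑ r ∈ Finset.range m,
    ∏ i ∈ Finset.range k, g ((x : ZMod m) + (i : ZMod m) * (r : ZMod m))) / (m : ℝ) ^ 2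

/-- a rational number interpreted in `ZMod m`. -/
def ratZMod (q : ℚ) (m : ℕ) : ZMod m := (q.num : ZMod m) * (q.den : ZMod m)⁻¹

/-- the `(m₀,t₀,L₀)`-linear forms condition for a family `ν = ν_N : Z_{M(N)} → ℝ`. -/
def LinearFormsCondition (M : ℕ → ℕ) (ν : ∀ N : ℕ, ZMod (M N) → ℝ) (m₀ t₀ L₀ : ℕ) : Prop :=
  ∀ m t : ℕ, m ≤ m₀ → t ≤ t₀ →
    ∀ L : Fin m → Fin t → ℚ,
      (∀ i j, (L i j).num.natAbs ≤ L₀ ∧ (L i j).den ≤ L₀) →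
      (∀ i, L i ≠ 0) →
      (∀ i i', i ≠ i' → ∀ q : ℚ, L i ≠ q • L i') →
      ∀ δ : ℝ, 0 < δ → ∃ N₀ : ℕ, ∀ N ≥ N₀, L₀ < M N →
        ∀ b : Fin m → ZMod (M N),
          |(∑ x : Fin t → Fin (M N), ∏ i : Fin m,
              ν N (∑ j : Fin t, ratZMod (L i j) (M N) * ((x j : ℕ) : ZMod (M N)) + b i)) /
              (M N : ℝ) ^ t - 1| ≤ δ

/-- the `m₀`-correlation condition for a family `ν = ν_N : Z_{M(N)} → ℝ`. -/
def CorrelationCondition (M : ℕ → ℕ) (ν : ∀ N : ℕ, ZMod (M N) → ℝ) (m₀ : ℕ) : Prop :=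
  ∀ m : ℕ, 1 < m → m ≤ m₀ →
    ∃ τ : ∀ N : ℕ, ZMod (M N) → ℝ,
      (∀ N n, 0 ≤ τ N n) ∧
      (∀ q : ℝ, 1 ≤ q → ∃ C : ℝ, ∀ N, avgZ (M N) (fun n => τ N n ^ q) ≤ C) ∧
      (∀ N : ℕ, ∀ h : Fin m → ZMod (M N),
        avgZ (M N) (fun x => ∏ i, ν N (x + h i)) ≤
          ∑ i : Fin m, ∑ j : Fin m, if i < j then τ N (h i - h j) else 0)

/-- `k`-pseudorandom measure. -/
def Pseudorandom (k : ℕ) (M : ℕ → ℕ) (ν : ∀ N : ℕ, ZMod (M N) → ℝ) : Prop :=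
  (∀ δ : ℝ, 0 < δ → ∃ N₀, ∀ N ≥ N₀, |avgZ (M N) (ν N) - 1| ≤ δ) ∧
  LinearFormsCondition M ν (k * 2 ^ (k - 1)) (3 * k - 4) k ∧
  CorrelationCondition M ν (2 ^ (k - 1))

lemma squarefree_prod_primes {D : Finset ℕ} (hD : ∀ p ∈ D, p.Prime) :
    Squarefree (∏ p ∈ D, p) := by
  refine Finset.squarefree_prod_of_pairwise_isCoprime ?_ fun p hp => (hD p hp).prime.squarefree
  intro p hp q hq hpq
  exact Nat.coprime_iff_isRelPrime.1 ((Nat.coprime_primes (hD p hp) (hD q hq)).2 hpq)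

lemma moebius_prod_primes {D : Finset ℕ} (hD : ∀ p ∈ D, p.Prime) :
    ArithmeticFunction.moebius (∏ p ∈ D, p) = (-1) ^ D.card := by
  rw [ArithmeticFunction.isMultiplicative_moebius.map_prod_of_prime D hD,
    Finset.prod_congr rfl fun p hp => ArithmeticFunction.moebius_apply_prime (hD p hp),
    Finset.prod_const]

/-- Sums over subsets of a finite set of primes are sums over squarefree integers. -/
lemma sum_powerset_primes (P : Finset ℕ) (hP : ∀ p ∈ P, p.Prime) (T : Finset ℕ) (g : ℕ → ℝ)
    (h1 : ∀ d, Squarefree d → d.primeFactors ⊆ P → g d ≠ 0 → d ∈ T)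
    (h2 : ∀ d ∈ T, g d ≠ 0 → Squarefree d ∧ d.primeFactors ⊆ P) :
    ∑ D ∈ P.powerset, g (∏ p ∈ D, p) = ∑ d ∈ T, g d := by
  have hpr : ∀ D ∈ P.powerset, ∀ p ∈ D, p.Prime := fun D hD p hp => hP p (mem_powerset.1 hD hp)
  have hpf : ∀ D ∈ P.powerset, (∏ p ∈ D, p).primeFactors = D := fun D hD =>
    Nat.primeFactors_prod (hpr D hD)
  refine Finset.sum_bij_ne_zero (fun D _ _ => ∏ p ∈ D, p) ?_ ?_ ?_ ?_
  · intro D hD hne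
    exact h1 _ (squarefree_prod_primes (hpr D hD)) (by rw [hpf D hD]; exact mem_powerset.1 hD) hne
  · intro D hD _ D' hD' _ h
    rw [← hpf D hD, ← hpf D' hD']
    exact congrArg _ h
  · intro d hd hne
    obtain ⟨hs, hsub⟩ := h2 d hd hne
    have := Nat.prod_primeFactors_of_squarefree hs
    exact ⟨d.primeFactors, mem_powerset.2 hsub, by rwa [this], this⟩
  · intros; rfl

lemma moebius_ne_zero_squarefree {d : ℕ}
    (h : ((ArithmeticFunction.moebius d : ℤ) : ℝ) ≠ 0) : Squarefree d :=
  ArithmeticFunction.moebius_ne_zero_iff_squarefree.1 (by exact_mod_cast h)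

lemma abs_moebius_real_le_one (d : ℕ) : |((ArithmeticFunction.moebius d : ℤ) : ℝ)| ≤ 1 := by
  have := ArithmeticFunction.abs_moebius_le_one (n := d)
  exact_mod_cast this

/-- The sum of the Möbius function over divisors free of the primes in `Q`. -/
lemma sum_moebius_avoid (Q : Finset ℕ) (hQ : ∀ p ∈ Q, p.Prime) {n : ℕ} (hn : n ≠ 0) :
    ∑ d ∈ n.divisors with ∀ p ∈ Q, ¬ p ∣ d, ((ArithmeticFunction.moebius d : ℤ) : ℝ) =
      if n.primeFactors ⊆ Q then 1 else 0 := by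
  have hpr : ∀ p ∈ n.primeFactors \ Q, p.Prime :=
    fun p hp => Nat.prime_of_mem_primeFactors (mem_sdiff.1 hp).1
  rw [← sum_powerset_primes (n.primeFactors \ Q) hpr]
  · have : ∀ D ∈ (n.primeFactors \ Q).powerset,
        ((ArithmeticFunction.moebius (∏ p ∈ D, p) : ℤ) : ℝ) = (((-1) ^ D.card : ℤ) : ℝ) := by
      intro D hD
      rw [moebius_prod_primes fun p hp => hpr p (mem_powerset.1 hD hp)]
    rw [Finset.sum_congr rfl this, ← Int.cast_sum, Finset.sum_powerset_neg_one_pow_card]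
    simp only [sdiff_eq_empty_iff_subset]
    split_ifs <;> simp
  · intro d hd hsub _
    simp only [mem_filter, Nat.mem_divisors]
    refine ⟨⟨?_, hn⟩, fun p hp hpd => ?_⟩
    · rw [← Nat.prod_primeFactors_of_squarefree hd]
      exact dvd_trans (Finset.prod_dvd_prod_of_subset _ _ _ (hsub.trans sdiff_subset))
        (Nat.prod_primeFactors_dvd n)
    · exact (mem_sdiff.1 (hsub (Nat.mem_primeFactors.2 ⟨hQ p hp, hpd, hd.ne_zero⟩))).2 hp
  · intro d hd hne
    simp only [mem_filter, Nat.mem_divisors] at hd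
    refine ⟨moebius_ne_zero_squarefree hne, fun p hp => mem_sdiff.2 ⟨?_, fun hpQ => ?_⟩⟩
    · exact Nat.primeFactors_mono hd.1.1 hn hp
    · exact hd.2 p hpQ (Nat.dvd_of_mem_primeFactors hp)

/-- Rearrangement of a double sum along divisors. -/
lemma sum_mul_sum_div (N : ℕ) (c : ℕ → Prop) [DecidablePred c] (u a : ℕ → ℝ) :
    ∑ d ∈ Icc 1 N with c d, u d * ∑ k ∈ Icc 1 (N / d), a (d * k) =
      ∑ n ∈ Icc 1 N, a n * ∑ d ∈ n.divisors with c d, u d := by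
  simp_rw [Finset.mul_sum]
  rw [Finset.sum_sigma', Finset.sum_sigma']
  refine Finset.sum_bij' (fun x _ => ⟨x.1 * x.2, x.1⟩) (fun y _ => ⟨y.2, y.1 / y.2⟩) ?_ ?_ ?_ ?_ ?_
  · rintro ⟨d, k⟩ h
    simp only [mem_sigma, mem_filter, mem_Icc, Nat.mem_divisors] at h ⊢
    obtain ⟨⟨⟨h1, h2⟩, h3⟩, h4, h5⟩ := h
    have : d * k ≤ N := by
      rw [mul_comm]; exact (Nat.le_div_iff_mul_le (by lia)).1 h5
    exact ⟨⟨Nat.mul_pos h1 h4, this⟩, ⟨dvd_mul_right _ _, (Nat.mul_pos h1 h4).ne'⟩, h3⟩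
  · rintro ⟨n, d⟩ h
    simp only [mem_sigma, mem_filter, mem_Icc, Nat.mem_divisors] at h ⊢
    obtain ⟨⟨h1, h2⟩, ⟨h3, h4⟩, h5⟩ := h
    have hd := Nat.pos_of_dvd_of_pos h3 h1
    have hle := Nat.le_of_dvd h1 h3
    exact ⟨⟨⟨hd, hle.trans h2⟩, h5⟩, Nat.div_pos hle hd, Nat.div_le_div_right h2⟩
  · rintro ⟨d, k⟩ h
    simp only [mem_sigma, mem_filter, mem_Icc] at h
    simp [Nat.mul_div_cancel_left k (show 0 < d by lia)]
  · rintro ⟨n, d⟩ h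
    simp only [mem_sigma, mem_filter, mem_Icc, Nat.mem_divisors] at h
    simp [Nat.mul_div_cancel' h.2.1.1]
  · rintro ⟨d, k⟩ h
    ring

/-- The Euler factor `∏ (1 - 1/p)⁻¹`. -/
def eulerFac (Q : Finset ℕ) : ℝ := ∏ p ∈ Q, (1 - (p : ℝ)⁻¹)⁻¹

lemma one_le_eulerFac_term {p : ℕ} (hp : p.Prime) : 1 ≤ (1 - (p : ℝ)⁻¹)⁻¹ := by
  have h2 : (2 : ℝ) ≤ p := by exact_mod_cast hp.two_le
  have h3 : (p : ℝ)⁻¹ ≤ 2⁻¹ := inv_anti₀ (by norm_num) h2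
  have h4 : 0 < (p : ℝ)⁻¹ := by positivity
  exact (one_le_inv₀ (by linarith)).2 (by linarith)

lemma eulerFac_term_le_two {p : ℕ} (hp : p.Prime) : (1 - (p : ℝ)⁻¹)⁻¹ ≤ 2 := by
  have h2 : (2 : ℝ) ≤ p := by exact_mod_cast hp.two_le
  have h3 : (p : ℝ)⁻¹ ≤ 2⁻¹ := inv_anti₀ (by norm_num) h2
  exact inv_le_of_inv_le₀ (by norm_num) (by linarith)

lemma one_le_eulerFac {Q : Finset ℕ} (hQ : ∀ p ∈ Q, p.Prime) : 1 ≤ eulerFac Q :=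
  le_trans (by simp) (Finset.prod_le_prod (s := Q) (f := fun _ => (1 : ℝ))
    (fun _ _ => zero_le_one) fun p hp => one_le_eulerFac_term (hQ p hp))

/-- Harmonic sums over integers composed of primes in `Q`. -/
lemma sum_inv_factored_le (Q : Finset ℕ) (hQ : ∀ p ∈ Q, p.Prime) (N : ℕ) :
    ∑ n ∈ Icc 1 N, (n : ℝ)⁻¹ * (if n.primeFactors ⊆ Q then 1 else 0) ≤ eulerFac Q := by
  let f : ℕ →* ℝ :=
    { toFun := fun n => (n : ℝ)⁻¹
      map_one' := by simp
      map_mul' := fun a b => by push_cast; rw [mul_inv] }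
  have hf : ∀ {p : ℕ}, p.Prime → ‖f p‖ < 1 := by
    intro p hp
    change ‖(p : ℝ)⁻¹‖ < 1
    rw [norm_inv, Real.norm_natCast]
    exact inv_lt_one_of_one_lt₀ (by exact_mod_cast hp.one_lt)
  have hs := (EulerProduct.summable_and_hasSum_factoredNumbers_prod_filter_prime_geometric hf Q).2
  have hs' : HasSum (fun n : ℕ => (Nat.factoredNumbers Q).indicator (fun n => (n : ℝ)⁻¹) n)
      (eulerFac Q) := by
    rw [← hasSum_subtype_iff_indicator]
    rw [Finset.filter_true_of_mem hQ] at hs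
    exact hs
  refine le_trans (Finset.sum_le_sum fun n hn => ?_) (hs'.summable.sum_le_tsum (Icc 1 N) ?_ |>.trans
    hs'.tsum_eq.le)
  · have hn0 : n ≠ 0 := by have := (mem_Icc.1 hn).1; lia
    by_cases h : n.primeFactors ⊆ Q
    · rw [if_pos h, mul_one, Set.indicator_of_mem]
      rw [Nat.mem_factoredNumbers_iff_primeFactors_subset]
      exact ⟨hn0, h⟩
    · rw [if_neg h, mul_zero]
      exact Set.indicator_nonneg (fun _ _ => by positivity) _
  · intro n _
    exact Set.indicator_nonneg (fun _ _ => by positivity) _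

lemma floor_div_nat (x : ℝ) (d : ℕ) : ⌊x⌋₊ / d = ⌊x / d⌋₊ := (Nat.floor_div_natCast x d).symm

lemma abs_sum_moebius_div_le (Q : Finset ℕ) (hQ : ∀ p ∈ Q, p.Prime) {x : ℝ} (hx : 1 ≤ x) :
    |∑ d ∈ Icc 1 ⌊x⌋₊ with ∀ p ∈ Q, ¬ p ∣ d,
      ((ArithmeticFunction.moebius d : ℤ) : ℝ) * (d : ℝ)⁻¹| ≤ 2 := by
  set N := ⌊x⌋₊ with hN
  set S := {d ∈ Icc 1 N | ∀ p ∈ Q, ¬ p ∣ d} with hS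
  set mu : ℕ → ℝ := fun d => ((ArithmeticFunction.moebius d : ℤ) : ℝ) with hmu
  have hx0 : 0 < x := by linarith
  have hNx : (N : ℝ) ≤ x := Nat.floor_le hx0.le
  have h1 := sum_mul_sum_div N (fun d => ∀ p ∈ Q, ¬ p ∣ d) mu (fun _ => (1 : ℝ))
  have h2 : ∑ n ∈ Icc 1 N, (1 : ℝ) * ∑ d ∈ n.divisors with ∀ p ∈ Q, ¬ p ∣ d, mu d =
      ∑ n ∈ Icc 1 N, if n.primeFactors ⊆ Q then 1 else 0 := by
    refine Finset.sum_congr rfl fun n hn => ?_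
    rw [one_mul, hmu, sum_moebius_avoid Q hQ (by have := (mem_Icc.1 hn).1; lia)]
  rw [h2] at h1
  have h3 : 0 ≤ ∑ n ∈ Icc 1 N, (if n.primeFactors ⊆ Q then (1 : ℝ) else 0) :=
    Finset.sum_nonneg fun _ _ => by split_ifs <;> norm_num
  have h4 : ∑ n ∈ Icc 1 N, (if n.primeFactors ⊆ Q then (1 : ℝ) else 0) ≤ N := by
    refine (Finset.sum_le_sum (g := fun _ => (1 : ℝ)) fun _ _ => by split_ifs <;> norm_num).trans ?_
    simp
  have hcard : (S.card : ℝ) ≤ N := by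
    have : S.card ≤ N := (Finset.card_filter_le _ _).trans (by simp)
    exact_mod_cast this
  have h5 : |∑ d ∈ S, mu d * ∑ k ∈ Icc 1 (N / d), (1 : ℝ) - ∑ d ∈ S, mu d * (x / d)| ≤ N := by
    rw [← Finset.sum_sub_distrib]
    refine (Finset.abs_sum_le_sum_abs _ _).trans ?_
    refine le_trans (Finset.sum_le_sum (g := fun _ => (1 : ℝ)) fun d hd => ?_)
      (by simpa using hcard)
    have hd0 : 1 ≤ d := (mem_Icc.1 (mem_filter.1 hd).1).1
    rw [← mul_sub, abs_mul]
    have : |∑ k ∈ Icc 1 (N / d), (1 : ℝ) - x / d| ≤ 1 := by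
      simp only [sum_const, Nat.card_Icc, add_tsub_cancel_right, nsmul_eq_mul, mul_one]
      rw [hN, floor_div_nat, abs_sub_comm, abs_le]
      have := Nat.floor_le (show 0 ≤ x / d by positivity)
      have := Nat.lt_floor_add_one (x / d)
      constructor <;> linarith
    exact mul_le_one₀ (abs_moebius_real_le_one d) (abs_nonneg _) this
  have h6 : ∑ d ∈ S, mu d * (x / d) = x * ∑ d ∈ S, mu d * (d : ℝ)⁻¹ := by
    rw [Finset.mul_sum]; exact Finset.sum_congr rfl fun d _ => by ring
  rw [h1, h6] at h5
  rw [abs_le] at h5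
  rw [abs_le]
  set A := ∑ d ∈ S, mu d * (d : ℝ)⁻¹
  constructor
  · nlinarith
  · nlinarith

lemma abs_harmonic_sub_log_le {y : ℝ} (hy : 1 ≤ y) :
    |∑ k ∈ Icc 1 ⌊y⌋₊, (k : ℝ)⁻¹ - Real.log y - Real.eulerMascheroniConstant| ≤ 2 / y := by
  set n := ⌊y⌋₊ with hn
  have hn1 : 1 ≤ n := Nat.le_floor (by simpa using hy)
  have hn1' : (1 : ℝ) ≤ n := by exact_mod_cast hn1
  have hny : (n : ℝ) ≤ y := Nat.floor_le (by linarith)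
  have hyn : y < n + 1 := Nat.lt_floor_add_one y
  have h1 := Real.eulerMascheroniSeq_lt_eulerMascheroniConstant n
  have h2 := Real.eulerMascheroniConstant_lt_eulerMascheroniSeq' n
  rw [Real.eulerMascheroniSeq] at h1
  rw [Real.eulerMascheroniSeq', if_neg (by lia)] at h2
  have hH : ((harmonic n : ℚ) : ℝ) = ∑ k ∈ Icc 1 n, (k : ℝ)⁻¹ := by
    rw [harmonic_eq_sum_Icc]; push_cast; rfl
  rw [hH] at h1 h2
  have h3 : Real.log n ≤ Real.log y := Real.log_le_log (by linarith) hny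
  have h4 : Real.log y ≤ Real.log (n + 1) := Real.log_le_log (by linarith) hyn.le
  have h5 : Real.log (n + 1) - Real.log n ≤ 1 / n := by
    rw [← Real.log_div (by positivity) (by positivity)]
    refine (Real.log_le_sub_one_of_pos (by positivity)).trans (le_of_eq ?_)
    field_simp; ring
  have h6 : (1 : ℝ) / n ≤ 2 / y := by
    rw [div_le_div_iff₀ (by linarith) (by linarith)]; linarith
  rw [abs_le]
  constructor <;> linarith

/-- Uniform bound for the logarithmically weighted Möbius sum over integers free of the
primes in `Q`. -/
lemma abs_sum_moebius_div_log_le (Q : Finset ℕ) (hQ : ∀ p ∈ Q, p.Prime) {x : ℝ} (hx : 1 ≤ x) :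
    |∑ d ∈ Icc 1 ⌊x⌋₊ with ∀ p ∈ Q, ¬ p ∣ d,
      ((ArithmeticFunction.moebius d : ℤ) : ℝ) * (d : ℝ)⁻¹ * Real.log (x / d)| ≤
        5 * eulerFac Q := by
  set N := ⌊x⌋₊ with hN
  set S := {d ∈ Icc 1 N | ∀ p ∈ Q, ¬ p ∣ d} with hS
  set mu : ℕ → ℝ := fun d => ((ArithmeticFunction.moebius d : ℤ) : ℝ) with hmu
  set γ := Real.eulerMascheroniConstant with hγ
  have hx0 : 0 < x := by linarith
  have hNx : (N : ℝ) ≤ x := Nat.floor_le hx0.le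
  have h1 : ∑ d ∈ S, mu d * ∑ k ∈ Icc 1 (N / d), ((d * k : ℕ) : ℝ)⁻¹ =
      ∑ n ∈ Icc 1 N, (n : ℝ)⁻¹ * if n.primeFactors ⊆ Q then 1 else 0 := by
    rw [sum_mul_sum_div N (fun d => ∀ p ∈ Q, ¬ p ∣ d) mu (fun n => (n : ℝ)⁻¹)]
    refine Finset.sum_congr rfl fun n hn => ?_
    rw [hmu, sum_moebius_avoid Q hQ (by have := (mem_Icc.1 hn).1; lia)]
  have h3 : 0 ≤ ∑ n ∈ Icc 1 N, (n : ℝ)⁻¹ * (if n.primeFactors ⊆ Q then (1 : ℝ) else 0) :=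
    Finset.sum_nonneg fun _ _ => by split_ifs <;> simp
  have h4 := sum_inv_factored_le Q hQ N
  have h4' := one_le_eulerFac hQ
  have hcard : (S.card : ℝ) ≤ N := by
    have : S.card ≤ N := (Finset.card_filter_le _ _).trans (by simp)
    exact_mod_cast this
  have h5 : |∑ d ∈ S, mu d * ∑ k ∈ Icc 1 (N / d), ((d * k : ℕ) : ℝ)⁻¹ -
      ∑ d ∈ S, (mu d * (d : ℝ)⁻¹ * Real.log (x / d) + γ * (mu d * (d : ℝ)⁻¹))| ≤ 2 := by
    rw [← Finset.sum_sub_distrib]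
    refine (Finset.abs_sum_le_sum_abs _ _).trans ?_
    refine le_trans (Finset.sum_le_sum (g := fun _ => (2 / x : ℝ)) fun d hd => ?_) ?_
    · have hd1 := mem_Icc.1 (mem_filter.1 hd).1
      have hd0 : (0 : ℝ) < d := by exact_mod_cast hd1.1
      have hdx : (d : ℝ) ≤ x := le_trans (by exact_mod_cast hd1.2) hNx
      have e : mu d * ∑ k ∈ Icc 1 (N / d), ((d * k : ℕ) : ℝ)⁻¹ -
          (mu d * (d : ℝ)⁻¹ * Real.log (x / d) + γ * (mu d * (d : ℝ)⁻¹)) =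
          mu d * ((d : ℝ)⁻¹ *
            (∑ k ∈ Icc 1 ⌊x / d⌋₊, (k : ℝ)⁻¹ - Real.log (x / d) - γ)) := by
        rw [hN, floor_div_nat]
        push_cast
        simp_rw [mul_inv, ← Finset.mul_sum]
        ring
      rw [e, abs_mul, abs_mul, abs_of_pos (inv_pos.2 hd0)]
      have hh := abs_harmonic_sub_log_le ((one_le_div hd0).2 hdx)
      calc |mu d| * ((d : ℝ)⁻¹ * |∑ k ∈ Icc 1 ⌊x / d⌋₊, (k : ℝ)⁻¹ - Real.log (x / d) - γ|)
          ≤ 1 * ((d : ℝ)⁻¹ * (2 / (x / d))) := by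
            gcongr
            exact abs_moebius_real_le_one d
        _ = 2 / x := by field_simp
    · rw [sum_const, nsmul_eq_mul]
      calc (S.card : ℝ) * (2 / x) ≤ x * (2 / x) := by gcongr; linarith
        _ = 2 := by field_simp
  have h6 := abs_sum_moebius_div_le Q hQ hx
  rw [Finset.sum_add_distrib, ← Finset.mul_sum, h1] at h5
  have g1 : 1 / 2 < γ := Real.one_half_lt_eulerMascheroniConstant
  have g2 : γ < 2 / 3 := Real.eulerMascheroniConstant_lt_two_thirds
  rw [abs_le] at h5 h6 ⊢
  change -2 ≤ ∑ d ∈ S, mu d * (d : ℝ)⁻¹ ∧ ∑ d ∈ S, mu d * (d : ℝ)⁻¹ ≤ 2 at h6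
  set A := ∑ d ∈ S, mu d * (d : ℝ)⁻¹
  set B := ∑ d ∈ S, mu d * (d : ℝ)⁻¹ * Real.log (x / d)
  have : γ * A ≤ 2 := by nlinarith
  have : -2 ≤ γ * A := by nlinarith
  constructor <;> linarith

/-- The signed logarithmic weight attached to the squarefree number `∏ D`. -/
def sieveWeight (R : ℝ) (D : Finset ℕ) : ℝ := (-1) ^ D.card * Real.posLog (R / ∏ p ∈ D, (p : ℝ))

/-- The truncated divisor sum over the squarefree numbers composed of primes in `Z`. -/
def sieveSum (R : ℝ) (Z : Finset ℕ) : ℝ := ∑ D ∈ Z.powerset, sieveWeight R D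

/-- The Selberg quadratic form. -/
def selbergForm (R : ℝ) (P : Finset ℕ) : ℝ :=
  ∑ D ∈ P.powerset, ∑ E ∈ P.powerset,
    sieveWeight R D * sieveWeight R E * ∏ p ∈ D ∪ E, (p : ℝ)⁻¹

lemma selbergForm_eq (R : ℝ) (P : Finset ℕ) (hP : ∀ p ∈ P, p.Prime) :
    selbergForm R P = ∑ r ∈ P.powerset, (∏ p ∈ r, ((p : ℝ) - 1)) *
      (∑ D ∈ P.powerset with r ⊆ D, sieveWeight R D * ∏ p ∈ D, (p : ℝ)⁻¹) ^ 2 := by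
  have key : ∀ D ∈ P.powerset, ∀ E ∈ P.powerset, ∏ p ∈ D ∪ E, (p : ℝ)⁻¹ =
      ∑ r ∈ P.powerset, (∏ p ∈ r, ((p : ℝ) - 1)) *
        ((if r ⊆ D then ∏ p ∈ D, (p : ℝ)⁻¹ else 0) * if r ⊆ E then ∏ p ∈ E, (p : ℝ)⁻¹ else 0) := by
    intro D hD E hE
    have h1 := Finset.prod_union_inter (s₁ := D) (s₂ := E) (f := fun p : ℕ => (p : ℝ)⁻¹)
    have h2 : ∏ p ∈ D ∩ E, (p : ℝ) = ∑ r ∈ (D ∩ E).powerset, ∏ p ∈ r, ((p : ℝ) - 1) := by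
      rw [← Finset.prod_one_add]; exact Finset.prod_congr rfl fun p _ => by ring
    have h3 : ∏ p ∈ D ∩ E, (p : ℝ) ≠ 0 := Finset.prod_ne_zero_iff.2 fun p hp =>
      Nat.cast_ne_zero.2 (hP p (mem_powerset.1 hD (mem_inter.1 hp).1)).ne_zero
    have h4 : ∏ p ∈ D ∪ E, (p : ℝ)⁻¹ =
        (∏ p ∈ D ∩ E, (p : ℝ)) * ((∏ p ∈ D, (p : ℝ)⁻¹) * ∏ p ∈ E, (p : ℝ)⁻¹) := by
      rw [← h1]
      rw [Finset.prod_inv_distrib (s := D ∩ E)]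
      field_simp
    rw [h4, h2, Finset.sum_mul]
    have hsub : (D ∩ E).powerset ⊆ P.powerset :=
      powerset_mono.2 (inter_subset_left.trans (mem_powerset.1 hD))
    rw [← Finset.sum_subset hsub]
    · refine Finset.sum_congr rfl fun r hr => ?_
      have hr' := subset_inter_iff.1 (mem_powerset.1 hr)
      rw [if_pos hr'.1, if_pos hr'.2]
    · intro r _ hr
      have : ¬ (r ⊆ D ∧ r ⊆ E) := fun h => hr (mem_powerset.2 (subset_inter_iff.2 h))
      by_cases h : r ⊆ D
      · rw [if_neg (fun h' => this ⟨h, h'⟩)]; simp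
      · rw [if_neg h]; simp
  have h1 : selbergForm R P = ∑ D ∈ P.powerset, ∑ E ∈ P.powerset, ∑ r ∈ P.powerset,
      (∏ p ∈ r, ((p : ℝ) - 1)) *
        ((if r ⊆ D then sieveWeight R D * ∏ p ∈ D, (p : ℝ)⁻¹ else 0) *
          if r ⊆ E then sieveWeight R E * ∏ p ∈ E, (p : ℝ)⁻¹ else 0) := by
    refine Finset.sum_congr rfl fun D hD => Finset.sum_congr rfl fun E hE => ?_
    rw [key D hD E hE, Finset.mul_sum]
    refine Finset.sum_congr rfl fun r _ => ?_
    split_ifs <;> ring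
  rw [h1]
  have h2 : ∀ D ∈ P.powerset, ∑ E ∈ P.powerset, ∑ r ∈ P.powerset,
      (∏ p ∈ r, ((p : ℝ) - 1)) *
        ((if r ⊆ D then sieveWeight R D * ∏ p ∈ D, (p : ℝ)⁻¹ else 0) *
          if r ⊆ E then sieveWeight R E * ∏ p ∈ E, (p : ℝ)⁻¹ else 0) =
      ∑ r ∈ P.powerset, ∑ E ∈ P.powerset,
      (∏ p ∈ r, ((p : ℝ) - 1)) *
        ((if r ⊆ D then sieveWeight R D * ∏ p ∈ D, (p : ℝ)⁻¹ else 0) *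
          if r ⊆ E then sieveWeight R E * ∏ p ∈ E, (p : ℝ)⁻¹ else 0) :=
    fun D _ => Finset.sum_comm
  rw [Finset.sum_congr rfl h2, Finset.sum_comm]
  refine Finset.sum_congr rfl fun r _ => ?_
  simp_rw [← Finset.mul_sum]
  congr 1
  rw [← Finset.sum_mul, ← Finset.sum_filter, sq]

lemma posLog_eq_zero_of_lt {x : ℝ} (h0 : 0 ≤ x) (h1 : x ≤ 1) : Real.posLog x = 0 :=
  (Real.posLog_eq_zero_iff x).2 (by rw [abs_of_nonneg h0]; exact h1)

lemma one_le_prod_cast {r : Finset ℕ} (hr : ∀ p ∈ r, p.Prime) : 1 ≤ ∏ p ∈ r, (p : ℝ) :=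
  le_trans (by simp) (Finset.prod_le_prod (s := r) (f := fun _ => (1 : ℝ))
    (fun _ _ => zero_le_one) fun p hp => by exact_mod_cast (hr p hp).one_le)

/-- The set of primes up to `K` that are not in `Q`. -/
def primesAvoiding (K : ℕ) (Q : Finset ℕ) : Finset ℕ :=
  {p ∈ Finset.range (K + 1) | p.Prime ∧ p ∉ Q}

lemma mem_primesAvoiding {K : ℕ} {Q : Finset ℕ} {p : ℕ} :
    p ∈ primesAvoiding K Q ↔ p ≤ K ∧ p.Prime ∧ p ∉ Q := by
  simp [primesAvoiding]

lemma sum_sieveWeight_superset {R : ℝ} (hR : 0 ≤ R) {K : ℕ} (hK : R ≤ K) {Q : Finset ℕ}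
    (hQ : ∀ p ∈ Q, p.Prime) {r : Finset ℕ} (hr : r ⊆ primesAvoiding K Q) :
    |∑ D ∈ (primesAvoiding K Q).powerset with r ⊆ D, sieveWeight R D * ∏ p ∈ D, (p : ℝ)⁻¹| ≤
      if ∏ p ∈ r, (p : ℝ) ≤ R then (∏ p ∈ r, (p : ℝ)⁻¹) * (5 * (eulerFac Q * eulerFac r))
      else 0 := by
  set P := primesAvoiding K Q with hP
  have hPp : ∀ p ∈ P, p.Prime := fun p hp => (mem_primesAvoiding.1 hp).2.1
  have hrp : ∀ p ∈ r, p.Prime := fun p hp => hPp p (hr hp)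
  have hr1 := one_le_prod_cast hrp
  set x := R / ∏ p ∈ r, (p : ℝ) with hx
  have hxR : x ≤ R := div_le_self hR hr1
  have hx0 : 0 ≤ x := by positivity
  have e1 : ∑ D ∈ P.powerset with r ⊆ D, sieveWeight R D * ∏ p ∈ D, (p : ℝ)⁻¹ =
      ∑ D ∈ (P \ r).powerset, ((-1) ^ r.card * ∏ p ∈ r, (p : ℝ)⁻¹) *
        ((-1) ^ D.card * (∏ p ∈ D, (p : ℝ)⁻¹) * Real.posLog (x / ∏ p ∈ D, (p : ℝ))) := by
    refine Finset.sum_bij' (fun D _ => D \ r) (fun D _ => D ∪ r) ?_ ?_ ?_ ?_ ?_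
    · intro D hD
      rw [mem_filter, mem_powerset] at hD
      exact mem_powerset.2 (sdiff_subset_sdiff hD.1 le_rfl)
    · intro D hD
      rw [mem_powerset] at hD
      rw [mem_filter, mem_powerset]
      exact ⟨union_subset (hD.trans sdiff_subset) hr, subset_union_right⟩
    · intro D hD
      rw [mem_filter] at hD
      exact sdiff_union_of_subset hD.2
    · intro D hD
      rw [mem_powerset] at hD
      exact union_sdiff_cancel_right (disjoint_of_subset_left hD sdiff_disjoint)
    · intro D hD
      rw [mem_filter] at hD
      have h1 : ∏ p ∈ D, (p : ℝ) = (∏ p ∈ D \ r, (p : ℝ)) * ∏ p ∈ r, (p : ℝ) :=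
        (Finset.prod_sdiff hD.2).symm
      have h2 : ∏ p ∈ D, (p : ℝ)⁻¹ = (∏ p ∈ D \ r, (p : ℝ)⁻¹) * ∏ p ∈ r, (p : ℝ)⁻¹ :=
        (Finset.prod_sdiff hD.2).symm
      have h3 : D.card = (D \ r).card + r.card := (card_sdiff_add_card_eq_card hD.2).symm
      rw [sieveWeight, h1, h2, h3, hx, pow_add, div_div, mul_comm (∏ p ∈ r, (p : ℝ))]
      ring
  rw [e1, ← Finset.mul_sum, abs_mul]
  have hinv : 0 ≤ ∏ p ∈ r, (p : ℝ)⁻¹ := Finset.prod_nonneg fun p _ => by positivity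
  have e2 : |(-1) ^ r.card * ∏ p ∈ r, (p : ℝ)⁻¹| = ∏ p ∈ r, (p : ℝ)⁻¹ := by
    rw [abs_mul, abs_pow, abs_neg, abs_one, one_pow, one_mul, abs_of_nonneg hinv]
  rw [e2]
  have hpr : ∀ p ∈ P \ r, p.Prime := fun p hp => hPp p (mem_sdiff.1 hp).1
  split_ifs with hle
  · have hx1 : 1 ≤ x := (one_le_div (by linarith)).2 hle
    refine mul_le_mul_of_nonneg_left ?_ hinv
    have hQr : ∀ p ∈ Q ∪ r, p.Prime := fun p hp =>
      (mem_union.1 hp).elim (hQ p) (hrp p)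
    have hdisj : Disjoint Q r := by
      rw [Finset.disjoint_left]
      exact fun p hp hpr => (mem_primesAvoiding.1 (hr hpr)).2.2 hp
    have hE : eulerFac Q * eulerFac r = eulerFac (Q ∪ r) := (Finset.prod_union hdisj).symm
    rw [hE]
    refine le_of_eq_of_le (congrArg _ ?_) (abs_sum_moebius_div_log_le (Q ∪ r) hQr hx1)
    have e3 := sum_powerset_primes (P \ r) hpr {d ∈ Icc 1 ⌊x⌋₊ | ∀ p ∈ Q ∪ r, ¬ p ∣ d}
      (fun d => ((ArithmeticFunction.moebius d : ℤ) : ℝ) * (d : ℝ)⁻¹ * Real.posLog (x / d)) ?_ ?_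
    · trans ∑ D ∈ (P \ r).powerset, ((ArithmeticFunction.moebius (∏ p ∈ D, p) : ℤ) : ℝ) *
          ((∏ p ∈ D, p : ℕ) : ℝ)⁻¹ * Real.posLog (x / (∏ p ∈ D, p : ℕ))
      · refine Finset.sum_congr rfl fun D hD => ?_
        rw [moebius_prod_primes fun p hp => hpr p (mem_powerset.1 hD hp)]
        push_cast
        rw [Finset.prod_inv_distrib]
      · rw [e3]
        refine Finset.sum_congr rfl fun d hd => ?_
        have hd1 := mem_Icc.1 (mem_filter.1 hd).1
        have hd0 : (0 : ℝ) < d := by exact_mod_cast hd1.1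
        have hdx : (d : ℝ) ≤ x := (Nat.le_floor_iff hx0).1 hd1.2
        rw [Real.posLog_eq_log]
        rw [abs_of_nonneg (by positivity)]
        exact (one_le_div hd0).2 hdx
    · intro d hd hsub hne
      have hd0 : (0 : ℝ) < d := by exact_mod_cast Nat.pos_of_ne_zero hd.ne_zero
      have hlog : Real.posLog (x / d) ≠ 0 := right_ne_zero_of_mul hne
      refine mem_filter.2 ⟨mem_Icc.2 ⟨Nat.pos_of_ne_zero hd.ne_zero, ?_⟩, fun p hp hpd => ?_⟩
      · refine Nat.le_floor ?_
        by_contra! hlt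
        exact hlog (posLog_eq_zero_of_lt (by positivity) ((div_le_one hd0).2 hlt.le))
      · have := hsub (Nat.mem_primeFactors.2 ⟨hQr p hp, hpd, hd.ne_zero⟩)
        rw [Finset.mem_sdiff, hP, mem_primesAvoiding] at this
        exact (mem_union.1 hp).elim this.1.2.2 this.2
    · intro d hd hne
      rw [mem_filter, mem_Icc] at hd
      refine ⟨moebius_ne_zero_squarefree (left_ne_zero_of_mul (left_ne_zero_of_mul hne)),
        fun p hp => ?_⟩
      have hpd := Nat.dvd_of_mem_primeFactors hp
      have hav : p ∉ Q ∪ r := fun h => hd.2 p h hpd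
      rw [notMem_union] at hav
      refine mem_sdiff.2 ⟨mem_primesAvoiding.2 ⟨?_, Nat.prime_of_mem_primeFactors hp, hav.1⟩, hav.2⟩
      have h1 : (d : ℝ) ≤ x := (Nat.le_floor_iff hx0).1 hd.1.2
      have h2 : d ≤ K := by exact_mod_cast h1.trans (hxR.trans hK)
      exact (Nat.le_of_dvd hd.1.1 hpd).trans h2
  · have hx1 : x < 1 := (div_lt_one (by linarith)).2 (not_le.1 hle)
    have : ∑ D ∈ (P \ r).powerset,
        ((-1) ^ D.card * (∏ p ∈ D, (p : ℝ)⁻¹) * Real.posLog (x / ∏ p ∈ D, (p : ℝ))) = 0 := by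
      refine Finset.sum_eq_zero fun D hD => ?_
      have hD1 := one_le_prod_cast fun p hp => hpr p (mem_powerset.1 hD hp)
      rw [posLog_eq_zero_of_lt (by positivity), mul_zero]
      exact (div_le_self hx0 hD1).trans hx1.le
    rw [this, abs_zero, mul_zero]

lemma selbergForm_le_sum {R : ℝ} (hR : 0 ≤ R) {K : ℕ} (hK : R ≤ K) {Q : Finset ℕ}
    (hQ : ∀ p ∈ Q, p.Prime) :
    selbergForm R (primesAvoiding K Q) ≤ 25 * eulerFac Q ^ 2 *
      ∑ r ∈ (primesAvoiding K Q).powerset with ∏ p ∈ (r : Finset ℕ), (p : ℝ) ≤ R,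
        ∏ p ∈ r, ((p : ℝ) - 1)⁻¹ := by
  have hPp : ∀ p ∈ primesAvoiding K Q, p.Prime := fun p hp => (mem_primesAvoiding.1 hp).2.1
  rw [selbergForm_eq R _ hPp, Finset.sum_filter, Finset.mul_sum]
  refine Finset.sum_le_sum fun r hr => ?_
  have hrP := mem_powerset.1 hr
  have hle := sum_sieveWeight_superset hR hK hQ hrP
  have hp1 : ∀ p ∈ r, (0 : ℝ) < p - 1 := fun p hp => by
    have : (1 : ℝ) < p := by exact_mod_cast (hPp p (hrP hp)).one_lt
    linarith
  have hnn : 0 ≤ ∏ p ∈ r, ((p : ℝ) - 1) := Finset.prod_nonneg fun p hp => (hp1 p hp).le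
  rw [← sq_abs]
  refine (mul_le_mul_of_nonneg_left (pow_le_pow_left₀ (abs_nonneg _) hle 2) hnn).trans (le_of_eq ?_)
  split_ifs
  · have : (∏ p ∈ r, ((p : ℝ) - 1)) * ((∏ p ∈ r, (p : ℝ)⁻¹) * eulerFac r) ^ 2 =
        ∏ p ∈ r, ((p : ℝ) - 1)⁻¹ := by
      rw [eulerFac, ← Finset.prod_mul_distrib, ← Finset.prod_pow, ← Finset.prod_mul_distrib]
      refine Finset.prod_congr rfl fun p hp => ?_
      have h1 := hp1 p hp
      have h2 : (p : ℝ) ≠ 0 := by intro h; rw [h] at h1; linarith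
      have h3 : (p : ℝ) - 1 ≠ 0 := h1.ne'
      rw [show 1 - (p : ℝ)⁻¹ = (p - 1) / p by field_simp]
      field_simp
    rw [← this]
    ring
  · simp

lemma sum_inv_mul_pred_le_one {P : Finset ℕ} (hP : ∀ p ∈ P, p.Prime) :
    ∑ p ∈ P, ((p : ℝ) * ((p : ℝ) - 1))⁻¹ ≤ 1 := by
  have htel : ∀ n : ℕ, ∑ i ∈ Finset.range n, (((i + 2 : ℕ) : ℝ) * (((i + 2 : ℕ) : ℝ) - 1))⁻¹ =
      1 - ((n : ℝ) + 1)⁻¹ := by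
    intro n
    induction n with
    | zero => simp
    | succ n ih =>
      rw [Finset.sum_range_succ, ih]
      push_cast
      have h1 : (n : ℝ) + 1 ≠ 0 := by positivity
      have h2 : (n : ℝ) + 2 ≠ 0 := by positivity
      have h3 : (n : ℝ) + 1 + 1 ≠ 0 := by positivity
      have h4 : (n : ℝ) + 2 - 1 ≠ 0 := by ring_nf; positivity
      field_simp
      ring
  have hsub : P ⊆ (Finset.range (P.sup id + 1)).image (fun i => i + 2) := by
    intro p hp
    have h2 := (hP p hp).two_le
    have h3 : p ≤ P.sup id := Finset.le_sup (f := id) hp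
    exact mem_image.2 ⟨p - 2, mem_range.2 (by omega), by omega⟩
  have hnn : ∀ n : ℕ, 0 ≤ ((n : ℝ) * ((n : ℝ) - 1))⁻¹ := by
    intro n
    rcases Nat.eq_zero_or_pos n with rfl | h
    · simp
    · have : (1 : ℝ) ≤ n := by exact_mod_cast h
      exact inv_nonneg.2 (mul_nonneg (by positivity) (by linarith))
  refine (Finset.sum_le_sum_of_subset_of_nonneg hsub fun p _ _ => hnn p).trans ?_
  rw [Finset.sum_image (by intro a _ b _ h; exact Nat.add_right_cancel h), htel]
  have : (0 : ℝ) ≤ (((P.sup id + 1 : ℕ) : ℝ) + 1)⁻¹ := by positivity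
  linarith

lemma prod_one_add_le_exp {α : Type*} (s : Finset α) (f : α → ℝ) (hf : ∀ a ∈ s, 0 ≤ f a) :
    ∏ a ∈ s, (1 + f a) ≤ Real.exp (∑ a ∈ s, f a) := by
  rw [Real.exp_sum]
  refine Finset.prod_le_prod (fun a ha => by linarith [hf a ha]) fun a _ => ?_
  rw [add_comm]
  exact Real.add_one_le_exp _

lemma sum_prod_pred_inv_le (R : ℝ) (P : Finset ℕ) (hP : ∀ p ∈ P, p.Prime) :
    ∑ r ∈ P.powerset with ∏ p ∈ (r : Finset ℕ), (p : ℝ) ≤ R, ∏ p ∈ r, ((p : ℝ) - 1)⁻¹ ≤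
      3 * ∑ r ∈ P.powerset with ∏ p ∈ (r : Finset ℕ), (p : ℝ) ≤ R, ∏ p ∈ r, (p : ℝ)⁻¹ := by
  set a : ℕ → ℝ := fun p => ((p : ℝ) * ((p : ℝ) - 1))⁻¹ with ha
  have hp1 : ∀ p ∈ P, (0 : ℝ) < p - 1 := fun p hp => by
    have : (1 : ℝ) < p := by exact_mod_cast (hP p hp).one_lt
    linarith
  have ha0 : ∀ p ∈ P, 0 ≤ a p := fun p hp =>
    inv_nonneg.2 (mul_nonneg (by positivity) (hp1 p hp).le)
  have hexp : ∀ r ∈ {r ∈ P.powerset | ∏ p ∈ (r : Finset ℕ), (p : ℝ) ≤ R},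
      ∏ p ∈ r, ((p : ℝ) - 1)⁻¹ =
        ∑ l ∈ r.powerset, (∏ p ∈ l, a p) * ∏ p ∈ r \ l, (p : ℝ)⁻¹ := by
    intro r hr
    rw [← Finset.prod_add]
    refine Finset.prod_congr rfl fun p hp => ?_
    have h1 := hp1 p (mem_powerset.1 (mem_filter.1 hr).1 hp)
    have h2 : (p : ℝ) ≠ 0 := by intro h; rw [h] at h1; linarith
    have h3 := h1.ne'
    rw [ha]
    field_simp
    ring
  rw [Finset.sum_congr rfl hexp]
  rw [Finset.sum_comm' (t' := P.powerset)
    (s' := fun l => {r ∈ P.powerset | ∏ p ∈ (r : Finset ℕ), (p : ℝ) ≤ R ∧ l ⊆ r})]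
  swap
  · intro r l
    simp only [mem_filter, mem_powerset]
    exact ⟨fun h => ⟨⟨h.1.1, h.1.2, h.2⟩, h.2.trans h.1.1⟩, fun h => ⟨⟨h.1.1, h.1.2.1⟩, h.1.2.2⟩⟩
  simp_rw [← Finset.mul_sum]
  have hinner : ∀ l ∈ P.powerset,
      ∑ r ∈ P.powerset with ∏ p ∈ (r : Finset ℕ), (p : ℝ) ≤ R ∧ l ⊆ r, ∏ p ∈ r \ l, (p : ℝ)⁻¹ ≤
      ∑ r ∈ P.powerset with ∏ p ∈ (r : Finset ℕ), (p : ℝ) ≤ R, ∏ p ∈ r, (p : ℝ)⁻¹ := by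
    intro l _
    rw [← Finset.sum_image (s := {r ∈ P.powerset | ∏ p ∈ (r : Finset ℕ), (p : ℝ) ≤ R ∧ l ⊆ r})
      (g := fun r : Finset ℕ => r \ l) (f := fun r : Finset ℕ => ∏ p ∈ r, (p : ℝ)⁻¹)]
    · refine Finset.sum_le_sum_of_subset_of_nonneg ?_ fun r _ _ =>
        Finset.prod_nonneg fun p _ => by positivity
      intro s hs
      obtain ⟨r, hr, rfl⟩ := mem_image.1 hs
      rw [mem_filter, mem_powerset] at hr ⊢
      refine ⟨sdiff_subset.trans hr.1, le_trans ?_ hr.2.1⟩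
      rw [← Finset.prod_sdiff hr.2.2]
      refine le_mul_of_one_le_right (Finset.prod_nonneg fun p _ => by positivity) ?_
      exact one_le_prod_cast fun p hp => hP p (hr.1 (hr.2.2 hp))
    · intro r hr s hs h
      have hr' := (mem_filter.1 (mem_coe.1 hr)).2.2
      have hs' := (mem_filter.1 (mem_coe.1 hs)).2.2
      simp only at h
      rw [← sdiff_union_of_subset hr', h, sdiff_union_of_subset hs']
  refine (Finset.sum_le_sum fun l hl => mul_le_mul_of_nonneg_left (hinner l hl)
    (Finset.prod_nonneg fun p hp => ha0 p (mem_powerset.1 hl hp))).trans ?_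
  rw [← Finset.sum_mul, ← Finset.prod_one_add]
  refine mul_le_mul_of_nonneg_right ?_ (Finset.sum_nonneg fun r _ =>
    Finset.prod_nonneg fun p _ => by positivity)
  refine (prod_one_add_le_exp P a ha0).trans ?_
  refine (Real.exp_le_exp.2 (sum_inv_mul_pred_le_one hP)).trans ?_
  linarith [Real.exp_one_lt_d9]

lemma sum_prod_inv_le_sum_coprime {R : ℝ} (W : ℕ) (P : Finset ℕ)
    (hP : ∀ p ∈ P, p.Prime) (hPW : ∀ p ∈ P, ¬ p ∣ W) :
    ∑ r ∈ P.powerset with ∏ p ∈ (r : Finset ℕ), (p : ℝ) ≤ R, ∏ p ∈ r, (p : ℝ)⁻¹ ≤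
      ∑ n ∈ Icc 1 ⌊R⌋₊ with W.Coprime n, (n : ℝ)⁻¹ := by
  set T : Finset ℕ := {n ∈ Icc 1 ⌊R⌋₊ | Squarefree n ∧ n.primeFactors ⊆ P} with hT
  have h := sum_powerset_primes P hP T (fun d => if (d : ℝ) ≤ R then (d : ℝ)⁻¹ else 0) ?_ ?_
  · rw [Finset.sum_filter]
    have e : ∀ r ∈ P.powerset, (if ∏ p ∈ r, (p : ℝ) ≤ R then ∏ p ∈ r, (p : ℝ)⁻¹ else 0) =
        if ((∏ p ∈ r, p : ℕ) : ℝ) ≤ R then ((∏ p ∈ r, p : ℕ) : ℝ)⁻¹ else 0 := by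
      intro r _
      push_cast
      rw [Finset.prod_inv_distrib]
    rw [Finset.sum_congr rfl e, h, hT]
    refine (Finset.sum_le_sum (g := fun n : ℕ => (n : ℝ)⁻¹) fun n _ => ?_).trans
      (Finset.sum_le_sum_of_subset_of_nonneg ?_ fun n _ _ => by positivity)
    · split_ifs
      · exact le_rfl
      · positivity
    · intro n hn
      rw [mem_filter] at hn ⊢
      refine ⟨hn.1, Nat.Coprime.symm (Nat.coprime_of_dvd fun p hp hpn hpW => ?_)⟩
      exact hPW p (hn.2.2 (Nat.mem_primeFactors.2 ⟨hp, hpn, hn.2.1.ne_zero⟩)) hpW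
  · intro d hd hsub hne
    have hd0 := Nat.pos_of_ne_zero hd.ne_zero
    refine mem_filter.2 ⟨mem_Icc.2 ⟨hd0, Nat.le_floor ?_⟩, hd, hsub⟩
    by_contra h
    exact hne (if_neg h)
  · intro d hd _
    exact (mem_filter.1 hd).2

lemma sum_coprime_inv_le {W : ℕ} (hW : 0 < W) (N : ℕ) :
    ∑ n ∈ Icc 1 N with W.Coprime n, (n : ℝ)⁻¹ ≤
      (1 + Real.log W) + (Nat.totient W : ℝ) / W * (1 + Real.log N) := by
  have hW0 : (0 : ℝ) < W := by exact_mod_cast hW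
  have hblock : ∀ j : ℕ, ∑ n ∈ Ico 1 (W * (j + 1)) with W.Coprime n, (n : ℝ)⁻¹ ≤
      (harmonic W : ℝ) + (Nat.totient W : ℝ) / W * (harmonic j : ℝ) := by
    intro j
    induction j with
    | zero =>
      rw [harmonic_zero]
      simp only [zero_add, mul_one, Rat.cast_zero, mul_zero, add_zero]
      rw [harmonic_eq_sum_Icc]
      push_cast
      refine Finset.sum_le_sum_of_subset_of_nonneg ?_ fun n _ _ => by positivity
      intro n hn
      have := mem_Ico.1 (mem_filter.1 hn).1
      exact mem_Icc.2 ⟨this.1, this.2.le⟩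
    | succ j ih =>
      have hle : W * (j + 1) ≤ W * (j + 1 + 1) := Nat.mul_le_mul_left _ (by omega)
      have h1 : 1 ≤ W * (j + 1) := Nat.mul_pos hW (by omega)
      rw [← Finset.Ico_union_Ico_eq_Ico h1 hle, Finset.filter_union, Finset.sum_union]
      · rw [harmonic_succ]
        push_cast
        have h2 : ∑ n ∈ Ico (W * (j + 1)) (W * (j + 1 + 1)) with W.Coprime n, (n : ℝ)⁻¹ ≤
            (Nat.totient W : ℝ) * ((W : ℝ) * (j + 1))⁻¹ := by
          rw [← Nat.filter_coprime_Ico_eq_totient W (W * (j + 1)), ← nsmul_eq_mul]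
          rw [show W * (j + 1) + W = W * (j + 1 + 1) by ring]
          refine Finset.sum_le_card_nsmul _ _ _ fun n hn => ?_
          have := (mem_Ico.1 (mem_filter.1 hn).1).1
          refine inv_anti₀ (by positivity) ?_
          exact_mod_cast this
        refine (add_le_add ih h2).trans (le_of_eq ?_)
        field_simp
        ring
      · refine Finset.disjoint_filter_filter ?_
        exact Finset.Ico_disjoint_Ico_consecutive _ _ _
  have hlogm : Real.log ((N / W : ℕ) : ℝ) ≤ Real.log N := by
    rcases Nat.eq_zero_or_pos (N / W) with h | h
    · rw [h]; simpa using Real.log_natCast_nonneg N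
    · exact Real.log_le_log (by exact_mod_cast h) (by exact_mod_cast Nat.div_le_self N W)
  have h1 := harmonic_le_one_add_log W
  have h2 := harmonic_le_one_add_log (N / W)
  refine le_trans (Finset.sum_le_sum_of_subset_of_nonneg ?_ fun n _ _ => by positivity)
    ((hblock (N / W)).trans (add_le_add h1 (mul_le_mul_of_nonneg_left
      (h2.trans (by linarith)) (by positivity))))
  intro n hn
  rw [mem_filter, mem_Icc] at hn
  refine mem_filter.2 ⟨mem_Ico.2 ⟨hn.1.1, lt_of_le_of_lt hn.1.2 ?_⟩, hn.2⟩
  exact Nat.lt_mul_div_succ N hW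

lemma eulerFac_primeFactors {W : ℕ} (hW : 0 < W) :
    eulerFac W.primeFactors = (W : ℝ) / Nat.totient W := by
  have h : (Nat.totient W : ℝ) = W * ∏ p ∈ W.primeFactors, (1 - (p : ℝ)⁻¹) := by
    have := congrArg (Rat.cast : ℚ → ℝ) (Nat.totient_eq_mul_prod_factors W)
    push_cast at this
    exact this
  have h0 : (Nat.totient W : ℝ) ≠ 0 := by exact_mod_cast (Nat.totient_pos.2 hW).ne'
  have hW0 : (W : ℝ) ≠ 0 := by exact_mod_cast hW.ne'
  rw [eulerFac, Finset.prod_inv_distrib, eq_div_iff h0, h]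
  have : ∏ p ∈ W.primeFactors, (1 - (p : ℝ)⁻¹) ≠ 0 := by
    intro h'; rw [h', mul_zero] at h; exact h0 h
  rw [mul_comm, mul_assoc, mul_inv_cancel₀ this, mul_one]

lemma eulerFac_union_le {Q f : Finset ℕ} (hQ : ∀ p ∈ Q, p.Prime) (hf : ∀ p ∈ f, p.Prime) :
    eulerFac (Q ∪ f) ≤ eulerFac Q * 2 ^ f.card := by
  rw [eulerFac, ← Finset.union_sdiff_self_eq_union, Finset.prod_union disjoint_sdiff]
  refine mul_le_mul_of_nonneg_left ?_ (zero_le_one.trans (one_le_eulerFac hQ))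
  calc ∏ p ∈ f \ Q, (1 - (p : ℝ)⁻¹)⁻¹ ≤ ∏ p ∈ f \ Q, (2 : ℝ) :=
        Finset.prod_le_prod (fun p hp => zero_le_one.trans (one_le_eulerFac_term
          (hf p (mem_sdiff.1 hp).1))) fun p hp => eulerFac_term_le_two (hf p (mem_sdiff.1 hp).1)
    _ = 2 ^ (f \ Q).card := by rw [Finset.prod_const]
    _ ≤ 2 ^ f.card := pow_le_pow_right₀ (by norm_num) (card_le_card sdiff_subset)

/-- Upper bound for the Selberg form over primes not dividing `W` and outside `f`. -/
lemma selbergForm_le {R L : ℝ} (hR : 0 ≤ R) {K : ℕ} (hK : R ≤ K) {W : ℕ} (hW : 0 < W)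
    {f : Finset ℕ} (hf : ∀ p ∈ f, p.Prime) (hL : 1 ≤ L) (hRL : Real.log ⌊R⌋₊ ≤ L)
    (hWL : W * (1 + Real.log W) ≤ L) :
    selbergForm R (primesAvoiding K (W.primeFactors ∪ f)) ≤
      225 * ((W : ℝ) / Nat.totient W * L) * 4 ^ f.card := by
  set Q := W.primeFactors ∪ f with hQdef
  have hWp : ∀ p ∈ W.primeFactors, p.Prime := fun p hp => Nat.prime_of_mem_primeFactors hp
  have hQ : ∀ p ∈ Q, p.Prime := fun p hp => (mem_union.1 hp).elim (hWp p) (hf p)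
  have hPp : ∀ p ∈ primesAvoiding K Q, p.Prime := fun p hp => (mem_primesAvoiding.1 hp).2.1
  have hPW : ∀ p ∈ primesAvoiding K Q, ¬ p ∣ W := fun p hp hpW =>
    (mem_primesAvoiding.1 hp).2.2 (mem_union_left _
      (Nat.mem_primeFactors.2 ⟨hPp p hp, hpW, hW.ne'⟩))
  have h1 := selbergForm_le_sum hR hK hQ
  have h2 := sum_prod_pred_inv_le R _ hPp
  have h3 := sum_prod_inv_le_sum_coprime (R := R) W _ hPp hPW
  have h4 := sum_coprime_inv_le hW ⌊R⌋₊
  have ht : (0 : ℝ) < Nat.totient W := by exact_mod_cast Nat.totient_pos.2 hW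
  have hW0 : (0 : ℝ) < W := by exact_mod_cast hW
  have h5 : (1 + Real.log W) + (Nat.totient W : ℝ) / W * (1 + Real.log ⌊R⌋₊) ≤
      3 * ((Nat.totient W : ℝ) / W * L) := by
    have : 1 + Real.log W ≤ (Nat.totient W : ℝ) / W * L := by
      rw [div_mul_eq_mul_div, le_div_iff₀ hW0]
      have : (1 : ℝ) ≤ Nat.totient W := by exact_mod_cast Nat.totient_pos.2 hW
      nlinarith
    have : (Nat.totient W : ℝ) / W * (1 + Real.log ⌊R⌋₊) ≤ (Nat.totient W : ℝ) / W * (2 * L) :=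
      mul_le_mul_of_nonneg_left (by linarith) (by positivity)
    linarith
  have h6 : eulerFac Q ^ 2 ≤ ((W : ℝ) / Nat.totient W) ^ 2 * 4 ^ f.card := by
    have h := eulerFac_union_le hWp hf
    rw [eulerFac_primeFactors hW] at h
    calc eulerFac Q ^ 2 ≤ ((W : ℝ) / Nat.totient W * 2 ^ f.card) ^ 2 :=
          pow_le_pow_left₀ (zero_le_one.trans (one_le_eulerFac hQ)) h 2
      _ = _ := by rw [mul_pow, ← pow_mul, mul_comm f.card, pow_mul]; norm_num
  calc _ ≤ 25 * eulerFac Q ^ 2 * (3 * (3 * ((Nat.totient W : ℝ) / W * L))) := by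
        refine h1.trans (mul_le_mul_of_nonneg_left (h2.trans ?_) (by positivity))
        exact mul_le_mul_of_nonneg_left (h3.trans (h4.trans h5)) (by norm_num)
    _ ≤ 25 * (((W : ℝ) / Nat.totient W) ^ 2 * 4 ^ f.card) *
          (3 * (3 * ((Nat.totient W : ℝ) / W * L))) :=
        mul_le_mul_of_nonneg_right (mul_le_mul_of_nonneg_left h6 (by norm_num)) (by positivity)
    _ = _ := by field_simp; ring

lemma sieveSum_inter_sq (R : ℝ) (A Z : Finset ℕ) :
    sieveSum R (Z ∩ A) ^ 2 = ∑ x ∈ A.powerset ×ˢ A.powerset,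
      sieveWeight R x.1 * sieveWeight R x.2 * (if x.1 ∪ x.2 ⊆ Z then 1 else 0) := by
  have h : sieveSum R (Z ∩ A) = ∑ D ∈ A.powerset, if D ⊆ Z then sieveWeight R D else 0 := by
    rw [sieveSum, ← Finset.sum_filter]
    refine Finset.sum_congr ?_ fun _ _ => rfl
    ext D
    rw [mem_filter, mem_powerset, mem_powerset, subset_inter_iff, and_comm]
  rw [h, sq, Finset.sum_mul_sum, Finset.sum_product]
  refine Finset.sum_congr rfl fun D _ => Finset.sum_congr rfl fun E _ => ?_
  simp only [union_subset_iff]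
  split_ifs <;> first | (exfalso; tauto) | ring

lemma prod_sieveSum_sq {ι : Type*} [Fintype ι] (R : ι → ℝ) (A : Finset ℕ) (Z : ι → Finset ℕ) :
    ∏ i, sieveSum (R i) (Z i ∩ A) ^ 2 =
      ∑ x ∈ Fintype.piFinset fun _ : ι => A.powerset ×ˢ A.powerset,
        (∏ i, sieveWeight (R i) (x i).1 * sieveWeight (R i) (x i).2) *
          ∏ i, (if (x i).1 ∪ (x i).2 ⊆ Z i then 1 else 0) := by
  simp_rw [sieveSum_inter_sq, Finset.prod_univ_sum, Finset.prod_mul_distrib]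

lemma selbergForm_eq_sum_product (R : ℝ) (A : Finset ℕ) :
    selbergForm R A = ∑ x ∈ A.powerset ×ˢ A.powerset,
      sieveWeight R x.1 * sieveWeight R x.2 * ∏ p ∈ x.1 ∪ x.2, (p : ℝ)⁻¹ := by
  rw [selbergForm, Finset.sum_product]

lemma selbergForm_nonneg (R : ℝ) (P : Finset ℕ) (hP : ∀ p ∈ P, p.Prime) :
    0 ≤ selbergForm R P := by
  rw [selbergForm_eq R P hP]
  refine Finset.sum_nonneg fun r hr => mul_nonneg (Finset.prod_nonneg fun p hp => ?_) (sq_nonneg _)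
  have : (1 : ℝ) ≤ p := by exact_mod_cast (hP p (mem_powerset.1 hr hp)).one_le
  linarith

/-- For a configuration attaching a set of indices to each prime, the set of primes attached
to a given index. -/
def attachedPrimes {ι : Type*} {P : Finset ℕ} (σ : P → Finset ι) (i : ι) : Finset ℕ :=
  {p ∈ P | ∃ h : p ∈ P, i ∈ σ ⟨p, h⟩}

lemma subset_attachedPrimes {ι : Type*} {P : Finset ℕ} {σ : P → Finset ι} {i : ι}
    {T : Finset ℕ} (hT : T ⊆ P) :
    T ⊆ attachedPrimes σ i ↔ ∀ p : P, (p : ℕ) ∈ T → i ∈ σ p := by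
  constructor
  · intro h p hp
    obtain ⟨_, h2⟩ := (mem_filter.1 (h hp)).2
    exact h2
  · exact fun h p hp => mem_filter.2 ⟨hT hp, hT hp, h ⟨p, hT hp⟩ hp⟩

lemma prod_indicator_eq {α : Type*} [Fintype α] (q : α → Prop) [DecidablePred q]
    [Decidable (∀ a, q a)] :
    ∏ a, (if q a then (1 : ℝ) else 0) = if ∀ a, q a then 1 else 0 := by
  split_ifs with h
  · exact Finset.prod_eq_one fun a _ => if_pos (h a)
  · obtain ⟨a, ha⟩ := not_forall.1 h
    exact Finset.prod_eq_zero (mem_univ a) (if_neg ha)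

lemma sum_config_indicator {ι : Type*} [Fintype ι] (P : Finset ℕ) (m : ℕ → Finset ι → ℝ)
    (T : ι → Finset ℕ) (hT : ∀ i, T i ⊆ P) :
    ∑ σ : P → Finset ι, (∏ p : P, m p (σ p)) *
        ∏ i, (if T i ⊆ attachedPrimes σ i then (1 : ℝ) else 0) =
      ∏ p ∈ P, ∑ B : Finset ι, m p B *
        (if (univ.filter fun i => p ∈ T i) ⊆ B then 1 else 0) := by
  have h : ∀ σ : P → Finset ι, ∏ i, (if T i ⊆ attachedPrimes σ i then (1 : ℝ) else 0) =
      ∏ p : P, (if (univ.filter fun i => (p : ℕ) ∈ T i) ⊆ σ p then (1 : ℝ) else 0) := by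
    intro σ
    rw [prod_indicator_eq, prod_indicator_eq]
    refine if_congr ?_ rfl rfl
    simp only [subset_attachedPrimes (hT _)]
    constructor
    · exact fun h p i hi => h i p (mem_filter.1 hi).2
    · exact fun h i p hp => h p (mem_filter.2 ⟨mem_univ _, hp⟩)
  simp_rw [h, ← Finset.prod_mul_distrib]
  rw [← Finset.prod_coe_sort P, Finset.prod_univ_sum]
  simp

lemma sum_config_sieve {ι : Type*} [Fintype ι] (R : ι → ℝ) (P A : Finset ℕ) (hA : A ⊆ P)
    (m : ℕ → Finset ι → ℝ) :
    ∑ σ : P → Finset ι, (∏ p : P, m p (σ p)) *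
        ∏ i, sieveSum (R i) (attachedPrimes σ i ∩ A) ^ 2 =
      ∑ x ∈ Fintype.piFinset fun _ : ι => A.powerset ×ˢ A.powerset,
        (∏ i, sieveWeight (R i) (x i).1 * sieveWeight (R i) (x i).2) *
          ∏ p ∈ P, ∑ B : Finset ι, m p B *
            (if (univ.filter fun i => p ∈ (x i).1 ∪ (x i).2) ⊆ B then 1 else 0) := by
  simp_rw [prod_sieveSum_sq, Finset.mul_sum]
  rw [Finset.sum_comm]
  refine Finset.sum_congr rfl fun x hx => ?_
  rw [← sum_config_indicator P m (fun i => (x i).1 ∪ (x i).2), Finset.mul_sum]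
  · refine Finset.sum_congr rfl fun σ _ => ?_
    ring
  · intro i
    have := mem_product.1 (Fintype.mem_piFinset.1 hx i)
    exact union_subset ((mem_powerset.1 this.1).trans hA) ((mem_powerset.1 this.2).trans hA)

/-- The product of Bernoulli measures of parameter `1 / p`. -/
def bernoulliWeight {ι : Type*} [Fintype ι] (p : ℕ) (B : Finset ι) : ℝ :=
  (∏ _i ∈ B, (p : ℝ)⁻¹) * ∏ _i ∈ univ \ B, (1 - (p : ℝ)⁻¹)

lemma sum_bernoulliWeight_superset {ι : Type*} [Fintype ι] (p : ℕ) (T : Finset ι) :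
    ∑ B : Finset ι, bernoulliWeight p B * (if T ⊆ B then 1 else 0) = ∏ _i ∈ T, (p : ℝ)⁻¹ := by
  have h := Finset.prod_add (fun _ : ι => (p : ℝ)⁻¹)
    (fun i => if i ∈ T then 0 else 1 - (p : ℝ)⁻¹) univ
  have h1 : ∀ i : ι, (p : ℝ)⁻¹ + (if i ∈ T then 0 else 1 - (p : ℝ)⁻¹) =
      if i ∈ T then (p : ℝ)⁻¹ else 1 := by
    intro i; split_ifs <;> ring
  simp_rw [h1] at h
  rw [Finset.prod_ite_mem, univ_inter] at h
  rw [h, powerset_univ]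
  refine Finset.sum_congr rfl fun B _ => ?_
  rw [bernoulliWeight, mul_assoc]
  congr 1
  split_ifs with hTB
  · rw [mul_one]
    refine Finset.prod_congr rfl fun i hi => ?_
    rw [if_neg fun h => (mem_sdiff.1 hi).2 (hTB h)]
  · obtain ⟨i, hi, hiB⟩ := not_subset.1 hTB
    have hi' : i ∈ univ \ B := mem_sdiff.2 ⟨mem_univ i, hiB⟩
    have hz : (if i ∈ T then (0 : ℝ) else 1 - (p : ℝ)⁻¹) = 0 := if_pos hi
    rw [mul_zero]
    exact (Finset.prod_eq_zero hi' hz).symm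

lemma bernoulliWeight_nonneg {ι : Type*} [Fintype ι] {p : ℕ} (hp : 1 ≤ p) (B : Finset ι) :
    0 ≤ bernoulliWeight p B := by
  have h1 : (p : ℝ)⁻¹ ≤ 1 := inv_le_one_of_one_le₀ (by exact_mod_cast hp)
  exact mul_nonneg (Finset.prod_nonneg fun _ _ => by positivity)
    (Finset.prod_nonneg fun _ _ => by linarith)

lemma sum_config_sieve_bernoulli {ι : Type*} [Fintype ι] (R : ι → ℝ) (P f : Finset ℕ)
    (hf : f ⊆ P) (κ : ℕ → Finset ι → ℝ) :
    ∑ σ : P → Finset ι,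
        (∏ p : P, (if (p : ℕ) ∈ f then κ p (σ p) else bernoulliWeight p (σ p))) *
        ∏ i, sieveSum (R i) (attachedPrimes σ i ∩ (P \ f)) ^ 2 =
      (∏ p ∈ f, ∑ B : Finset ι, κ p B) * ∏ i, selbergForm (R i) (P \ f) := by
  rw [sum_config_sieve R P (P \ f) sdiff_subset
    fun p B => if p ∈ f then κ p B else bernoulliWeight p B]
  simp_rw [selbergForm_eq_sum_product, Finset.prod_univ_sum, Finset.mul_sum]
  refine Finset.sum_congr rfl fun x hx => ?_
  have hxi : ∀ i, (x i).1 ∪ (x i).2 ⊆ P \ f := fun i => by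
    have := mem_product.1 (Fintype.mem_piFinset.1 hx i)
    exact union_subset (mem_powerset.1 this.1) (mem_powerset.1 this.2)
  rw [Finset.prod_mul_distrib (f := fun i => sieveWeight (R i) (x i).1 * sieveWeight (R i) (x i).2),
    ← mul_assoc, mul_comm (∏ p ∈ f, _), mul_assoc]
  congr 1
  rw [← Finset.prod_sdiff hf, mul_comm]
  congr 1
  · refine Finset.prod_congr rfl fun p hp => Finset.sum_congr rfl fun B _ => ?_
    have : (univ.filter fun i => p ∈ (x i).1 ∪ (x i).2) = ∅ := by
      refine filter_eq_empty_iff.2 fun i _ hi => (mem_sdiff.1 (hxi i hi)).2 hp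
    rw [this, if_pos hp, if_pos (empty_subset _), mul_one]
  · have h1 : ∀ p ∈ P \ f, ∑ B : Finset ι, (if p ∈ f then κ p B else bernoulliWeight p B) *
        (if (univ.filter fun i => p ∈ (x i).1 ∪ (x i).2) ⊆ B then 1 else 0) =
        ∏ i, if p ∈ (x i).1 ∪ (x i).2 then (p : ℝ)⁻¹ else 1 := by
      intro p hp
      simp_rw [if_neg (mem_sdiff.1 hp).2]
      rw [sum_bernoulliWeight_superset, Finset.prod_filter]
    rw [Finset.prod_congr rfl h1, Finset.prod_comm]
    refine Finset.prod_congr rfl fun i _ => ?_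
    rw [Finset.prod_ite_mem, inter_eq_right.2 (hxi i)]

lemma sieveWeight_union (R : ℝ) {d D : Finset ℕ} (h : Disjoint d D) :
    sieveWeight R (d ∪ D) = (-1) ^ d.card * sieveWeight (R / ∏ p ∈ d, (p : ℝ)) D := by
  rw [sieveWeight, sieveWeight, Finset.prod_union h, card_union_of_disjoint h, pow_add, div_div]
  ring

lemma sieveSum_eq_sum_inter (R : ℝ) (Z f : Finset ℕ) :
    sieveSum R Z = ∑ d ∈ (Z ∩ f).powerset,
      (-1) ^ d.card * sieveSum (R / ∏ p ∈ d, (p : ℝ)) (Z \ f) := by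
  simp_rw [sieveSum, Finset.mul_sum]
  rw [← Finset.sum_product']
  refine Finset.sum_bij' (fun D _ => (D ∩ f, D \ f)) (fun x _ => x.1 ∪ x.2) ?_ ?_ ?_ ?_ ?_
  · intro D hD
    rw [mem_powerset] at hD
    exact mem_product.2 ⟨mem_powerset.2 (inter_subset_inter_right hD),
      mem_powerset.2 (sdiff_subset_sdiff hD le_rfl)⟩
  · intro x hx
    rw [mem_product, mem_powerset, mem_powerset] at hx
    exact mem_powerset.2 (union_subset (hx.1.trans inter_subset_left) (hx.2.trans sdiff_subset))
  · intro D _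
    simp only
    rw [union_comm, sdiff_union_inter]
  · rintro ⟨d, D⟩ hx
    rw [mem_product, mem_powerset, mem_powerset] at hx
    have h1 : d ⊆ f := hx.1.trans inter_subset_right
    have h2 : ∀ p ∈ D, p ∉ f := fun p hp => (mem_sdiff.1 (hx.2 hp)).2
    ext p
    · simp only [mem_inter, mem_union]
      exact ⟨fun h => h.1.elim id fun h' => absurd h.2 (h2 p h'), fun h => ⟨Or.inl h, h1 h⟩⟩
    · simp only [Finset.mem_sdiff, mem_union]
      exact ⟨fun h => h.1.elim (fun h' => absurd (h1 h') h.2) id, fun h => ⟨Or.inr h, h2 p h⟩⟩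
  · intro D _
    rw [← sieveWeight_union R (disjoint_of_subset_left inter_subset_right disjoint_sdiff),
      union_comm, sdiff_union_inter]

lemma sieveSum_sq_le (R : ℝ) (Z f : Finset ℕ) :
    sieveSum R Z ^ 2 ≤
      2 ^ f.card * ∑ d ∈ f.powerset, sieveSum (R / ∏ p ∈ d, (p : ℝ)) (Z \ f) ^ 2 := by
  rw [sieveSum_eq_sum_inter R Z f]
  refine (sq_sum_le_card_mul_sum_sq).trans ?_
  have h1 : ∀ d ∈ (Z ∩ f).powerset,
      ((-1) ^ d.card * sieveSum (R / ∏ p ∈ d, (p : ℝ)) (Z \ f)) ^ 2 =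
        sieveSum (R / ∏ p ∈ d, (p : ℝ)) (Z \ f) ^ 2 := by
    intro d _
    rw [mul_pow, ← pow_mul, mul_comm d.card, pow_mul, neg_one_sq, one_pow, one_mul]
  rw [Finset.sum_congr rfl h1, card_powerset]
  push_cast
  refine mul_le_mul ?_ ?_ (Finset.sum_nonneg fun _ _ => sq_nonneg _) (by positivity)
  · exact pow_le_pow_right₀ (by norm_num) (card_le_card inter_subset_right)
  · exact Finset.sum_le_sum_of_subset_of_nonneg (powerset_mono.2 inter_subset_right)
      fun _ _ _ => sq_nonneg _

lemma prod_subtype_add {P : Finset ℕ} (a b : P → ℝ) :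
    ∏ p : P, (a p + b p) =
      ∑ f ∈ P.powerset, ∏ p : P, if (p : ℕ) ∈ f then a p else b p := by
  set a' : ℕ → ℝ := fun p => if h : p ∈ P then a ⟨p, h⟩ else 0 with ha'
  set b' : ℕ → ℝ := fun p => if h : p ∈ P then b ⟨p, h⟩ else 0 with hb'
  have ha : ∀ p : P, a p = a' p := fun p => by rw [ha']; simp
  have hb : ∀ p : P, b p = b' p := fun p => by rw [hb']; simp
  simp_rw [ha, hb]
  rw [Finset.prod_coe_sort P (fun p => a' p + b' p), Finset.prod_add]
  refine Finset.sum_congr rfl fun f hf => ?_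
  rw [Finset.prod_coe_sort P (fun p => if p ∈ f then a' p else b' p),
    ← Finset.prod_sdiff (mem_powerset.1 hf), mul_comm]
  congr 1
  · exact Finset.prod_congr rfl fun p hp => (if_neg (mem_sdiff.1 hp).2).symm
  · exact Finset.prod_congr rfl fun p hp => (if_pos hp).symm

lemma sum_config_sieve_le_of_subset {ι : Type*} [Fintype ι] {R V : ℝ} (hR : 0 ≤ R)
    {P f : Finset ℕ} (hP : ∀ p ∈ P, p.Prime) (hf : f ⊆ P)
    (hV : ∀ R', 0 ≤ R' → R' ≤ R → selbergForm R' (P \ f) ≤ V * 4 ^ f.card)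
    (κ : ℕ → Finset ι → ℝ) (hκ : ∀ p ∈ P, ∀ B, 0 ≤ κ p B) :
    ∑ σ : P → Finset ι,
        (∏ p : P, (if (p : ℕ) ∈ f then κ p (σ p) else bernoulliWeight p (σ p))) *
        ∏ i, sieveSum R (attachedPrimes σ i) ^ 2 ≤
      V ^ Fintype.card ι * ∏ p ∈ f, (16 ^ Fintype.card ι * ∑ B : Finset ι, κ p B) := by
  set m := Fintype.card ι with hm
  have hwt : ∀ σ : P → Finset ι,
      0 ≤ ∏ p : P, (if (p : ℕ) ∈ f then κ p (σ p) else bernoulliWeight p (σ p)) := by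
    intro σ
    refine Finset.prod_nonneg fun p _ => ?_
    split_ifs
    · exact hκ p p.2 _
    · exact bernoulliWeight_nonneg (hP p p.2).one_le _
  have hpt : ∀ σ : P → Finset ι, ∏ i, sieveSum R (attachedPrimes σ i) ^ 2 ≤
      (2 ^ f.card) ^ m * ∑ d ∈ Fintype.piFinset fun _ : ι => f.powerset,
        ∏ i, sieveSum (R / ∏ p ∈ d i, (p : ℝ)) (attachedPrimes σ i ∩ (P \ f)) ^ 2 := by
    intro σ
    have hZ : ∀ i, attachedPrimes σ i \ f = attachedPrimes σ i ∩ (P \ f) := fun i => by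
      ext p
      simp only [Finset.mem_sdiff, mem_inter]
      exact ⟨fun h => ⟨h.1, (mem_filter.1 h.1).1, h.2⟩, fun h => ⟨h.1, h.2.2⟩⟩
    refine (Finset.prod_le_prod (fun i _ => sq_nonneg _) fun i _ =>
      sieveSum_sq_le R (attachedPrimes σ i) f).trans (le_of_eq ?_)
    rw [Finset.prod_mul_distrib, Finset.prod_const, card_univ, ← hm, Finset.prod_univ_sum]
    simp_rw [hZ]
  refine (Finset.sum_le_sum fun σ _ => mul_le_mul_of_nonneg_left (hpt σ) (hwt σ)).trans ?_
  have hre : ∀ σ : P → Finset ι,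
      (∏ p : P, (if (p : ℕ) ∈ f then κ p (σ p) else bernoulliWeight p (σ p))) *
        ((2 ^ f.card) ^ m * ∑ d ∈ Fintype.piFinset fun _ : ι => f.powerset,
        ∏ i, sieveSum (R / ∏ p ∈ d i, (p : ℝ)) (attachedPrimes σ i ∩ (P \ f)) ^ 2) =
      ∑ d ∈ Fintype.piFinset fun _ : ι => f.powerset, (2 ^ f.card) ^ m *
        ((∏ p : P, (if (p : ℕ) ∈ f then κ p (σ p) else bernoulliWeight p (σ p))) *
        ∏ i, sieveSum (R / ∏ p ∈ d i, (p : ℝ)) (attachedPrimes σ i ∩ (P \ f)) ^ 2) := by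
    intro σ
    rw [Finset.mul_sum, Finset.mul_sum]
    exact Finset.sum_congr rfl fun d _ => by ring
  rw [Finset.sum_congr rfl fun σ _ => hre σ, Finset.sum_comm]
  have hκf : 0 ≤ ∏ p ∈ f, ∑ B : Finset ι, κ p B :=
    Finset.prod_nonneg fun p hp => Finset.sum_nonneg fun B _ => hκ p (hf hp) B
  have hd : ∀ d ∈ Fintype.piFinset fun _ : ι => f.powerset,
      ∑ σ : P → Finset ι, (2 ^ f.card) ^ m *
        ((∏ p : P, (if (p : ℕ) ∈ f then κ p (σ p) else bernoulliWeight p (σ p))) *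
        ∏ i, sieveSum (R / ∏ p ∈ d i, (p : ℝ)) (attachedPrimes σ i ∩ (P \ f)) ^ 2) ≤
      (2 ^ f.card) ^ m * ((∏ p ∈ f, ∑ B : Finset ι, κ p B) * (V * 4 ^ f.card) ^ m) := by
    intro d hd
    rw [← Finset.mul_sum,
      sum_config_sieve_bernoulli (fun i => R / ∏ p ∈ d i, (p : ℝ)) P f hf κ]
    refine mul_le_mul_of_nonneg_left (mul_le_mul_of_nonneg_left ?_ hκf) (by positivity)
    rw [hm, ← card_univ, ← Finset.prod_const]
    refine Finset.prod_le_prod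
      (fun i _ => selbergForm_nonneg _ _ fun p hp => hP p (mem_sdiff.1 hp).1) fun i _ => ?_
    have h1 : 1 ≤ ∏ p ∈ d i, (p : ℝ) := one_le_prod_cast fun p hp =>
      hP p (hf (mem_powerset.1 (Fintype.mem_piFinset.1 hd i) hp))
    exact hV _ (by positivity) (div_le_self hR h1)
  refine (Finset.sum_le_sum hd).trans (le_of_eq ?_)
  rw [Finset.sum_const, Fintype.card_piFinset, Finset.prod_const, card_univ, card_powerset,
    ← hm, nsmul_eq_mul, Finset.prod_mul_distrib, Finset.prod_const]
  push_cast
  have : (16 : ℝ) ^ m = 2 ^ m * 2 ^ m * 4 ^ m := by rw [← mul_pow, ← mul_pow]; norm_num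
  rw [this]
  ring

lemma sum_config_sieve_le {ι : Type*} [Fintype ι] {R V : ℝ} (hR : 0 ≤ R)
    {P : Finset ℕ} (hP : ∀ p ∈ P, p.Prime)
    (hV : ∀ f ⊆ P, ∀ R', 0 ≤ R' → R' ≤ R → selbergForm R' (P \ f) ≤ V * 4 ^ f.card)
    (μ κ : ℕ → Finset ι → ℝ) (hμ : ∀ p ∈ P, ∀ B, 0 ≤ μ p B) (hκ : ∀ p ∈ P, ∀ B, 0 ≤ κ p B)
    (hμκ : ∀ p ∈ P, ∀ B, μ p B ≤ κ p B + bernoulliWeight p B) :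
    ∑ σ : P → Finset ι, (∏ p : P, μ p (σ p)) * ∏ i, sieveSum R (attachedPrimes σ i) ^ 2 ≤
      V ^ Fintype.card ι * ∏ p ∈ P, (1 + 16 ^ Fintype.card ι * ∑ B : Finset ι, κ p B) := by
  have h1 : ∀ σ : P → Finset ι,
      (∏ p : P, μ p (σ p)) * ∏ i, sieveSum R (attachedPrimes σ i) ^ 2 ≤
      ∑ f ∈ P.powerset,
        (∏ p : P, (if (p : ℕ) ∈ f then κ p (σ p) else bernoulliWeight p (σ p))) *
        ∏ i, sieveSum R (attachedPrimes σ i) ^ 2 := by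
    intro σ
    rw [← Finset.sum_mul, ← prod_subtype_add (fun p : P => κ p (σ p))]
    refine mul_le_mul_of_nonneg_right ?_ (Finset.prod_nonneg fun i _ => sq_nonneg _)
    exact Finset.prod_le_prod (fun p _ => hμ p p.2 _) fun p _ => hμκ p p.2 _
  refine (Finset.sum_le_sum fun σ _ => h1 σ).trans ?_
  rw [Finset.sum_comm, Finset.prod_one_add, Finset.mul_sum]
  exact Finset.sum_le_sum fun f hf => sum_config_sieve_le_of_subset hR hP (mem_powerset.1 hf)
    (hV f (mem_powerset.1 hf)) κ hκ

/-- The indices `i` for which `p` divides `W (a + s i) + 1`. -/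
def localState {ι : Type*} [Fintype ι] (W : ℕ) (s : ι → ℤ) (p : ℕ) (a : ℤ) : Finset ι :=
  {i | (p : ℤ) ∣ W * (a + s i) + 1}

/-- The proportion of residues modulo `p` with a given local state. -/
def localDensity {ι : Type*} [Fintype ι] (W : ℕ) (s : ι → ℤ) (p : ℕ) (B : Finset ι) : ℝ :=
  (#{a ∈ Finset.range p | localState W s p (a : ℕ) = B} : ℝ) / p

lemma localDensity_nonneg {ι : Type*} [Fintype ι] (W : ℕ) (s : ι → ℤ) (p : ℕ) (B : Finset ι) :
    0 ≤ localDensity W s p B := by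
  rw [localDensity]; positivity

lemma sum_localDensity_superset {ι : Type*} [Fintype ι] (W : ℕ) (s : ι → ℤ) (p : ℕ)
    (T : Finset ι) :
    ∑ B : Finset ι, localDensity W s p B * (if T ⊆ B then 1 else 0) =
      (#{a ∈ Finset.range p | T ⊆ localState W s p (a : ℕ)} : ℝ) / p := by
  have h := Finset.card_eq_sum_card_fiberwise
    (s := {a ∈ Finset.range p | T ⊆ localState W s p (a : ℕ)})
    (t := univ) (f := fun a : ℕ => localState W s p a) (fun _ _ => mem_coe.2 (mem_univ _))
  rw [h]
  push_cast
  rw [Finset.sum_div]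
  refine Finset.sum_congr rfl fun B _ => ?_
  rw [localDensity, filter_filter]
  split_ifs with hTB
  · rw [mul_one]
    congr 3
    refine filter_congr fun a _ => ?_
    exact ⟨fun h => ⟨h ▸ hTB, h⟩, fun h => h.2⟩
  · have : #{a ∈ Finset.range p | T ⊆ localState W s p (a : ℕ) ∧
        localState W s p (a : ℕ) = B} = 0 := by
      refine card_eq_zero.2 (filter_eq_empty_iff.2 fun a _ h => hTB (h.2 ▸ h.1))
    rw [this]
    simp

lemma exists_local_roots {ι : Type*} [Fintype ι] {W : ℕ} (s : ι → ℤ) {p : ℕ} (hp : p.Prime)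
    (hpW : ¬ p ∣ W) :
    ∃ v : ι → ℕ, (∀ i, v i < p) ∧
      (∀ i (a : ℤ), i ∈ localState W s p a ↔ a ≡ v i [ZMOD p]) ∧
      ∀ i j, v i = v j → (p : ℤ) ∣ s i - s j := by
  have hcop : IsCoprime (W : ℤ) p := (Nat.isCoprime_iff_coprime).2
    (Nat.Coprime.symm ((Nat.Prime.coprime_iff_not_dvd hp).2 hpW))
  obtain ⟨c, d, hcd⟩ := hcop
  have hp0 : (0 : ℤ) < p := by exact_mod_cast hp.pos
  have hv : ∀ i, (((-c - s i) % p).toNat : ℤ) = (-c - s i) % p := fun i =>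
    Int.toNat_of_nonneg (Int.emod_nonneg _ hp0.ne')
  refine ⟨fun i => ((-c - s i) % p).toNat, fun i => ?_, fun i a => ?_, fun i j hij => ?_⟩
  · have := Int.emod_lt_of_pos (-c - s i) hp0
    rw [← hv] at this
    exact_mod_cast this
  · rw [localState, mem_filter, hv]
    simp only [mem_univ, true_and]
    have h1 : a ≡ (-c - s i) % p [ZMOD p] ↔ a ≡ -c - s i [ZMOD p] :=
      ⟨fun h => h.trans (Int.mod_modEq _ _), fun h => h.trans (Int.mod_modEq _ _).symm⟩
    rw [h1, Int.modEq_comm, Int.modEq_iff_dvd]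
    constructor
    · rintro ⟨e, he⟩
      refine ⟨c * e + d * (a + s i), ?_⟩
      linear_combination c * he - (a + s i) * hcd
    · rintro ⟨e, he⟩
      refine ⟨W * e + d, ?_⟩
      linear_combination (W : ℤ) * he - hcd
  · have h2 : (-c - s i) % p = (-c - s j) % p := by rw [← hv i, ← hv j]; exact_mod_cast hij
    obtain ⟨e, he⟩ := Int.ModEq.dvd h2
    exact ⟨e, by linear_combination he⟩

/-- The excess of the local density over the product Bernoulli measure. -/
def localExcess {ι : Type*} [Fintype ι] (W : ℕ) (s : ι → ℤ) (p : ℕ) (B : Finset ι) : ℝ :=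
  max 0 (localDensity W s p B - bernoulliWeight p B)

lemma localExcess_nonneg {ι : Type*} [Fintype ι] (W : ℕ) (s : ι → ℤ) (p : ℕ) (B : Finset ι) :
    0 ≤ localExcess W s p B := le_max_left _ _

lemma localDensity_le {ι : Type*} [Fintype ι] (W : ℕ) (s : ι → ℤ) (p : ℕ) (B : Finset ι) :
    localDensity W s p B ≤ localExcess W s p B + bernoulliWeight p B := by
  have := le_max_right 0 (localDensity W s p B - bernoulliWeight p B)
  rw [localExcess]; linarith

lemma bernoulliWeight_empty {ι : Type*} [Fintype ι] (p : ℕ) :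
    bernoulliWeight p (∅ : Finset ι) = (1 - (p : ℝ)⁻¹) ^ Fintype.card ι := by
  simp [bernoulliWeight]

lemma bernoulli_pow_ge {p : ℕ} (hp : p.Prime) (n : ℕ) :
    1 - n / (p : ℝ) ≤ (1 - (p : ℝ)⁻¹) ^ n := by
  have h1 : (p : ℝ)⁻¹ ≤ 1 := inv_le_one_of_one_le₀ (by exact_mod_cast hp.one_le)
  have h := one_add_mul_le_pow (a := -(p : ℝ)⁻¹) (by linarith) n
  rw [← sub_eq_add_neg] at h
  refine le_trans (le_of_eq ?_) h
  rw [div_eq_mul_inv]; ring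

lemma sum_localExcess_le {ι : Type*} [Fintype ι] {W : ℕ} (s : ι → ℤ) {p : ℕ} (hp : p.Prime)
    (hpW : ¬ p ∣ W) :
    ∑ B : Finset ι, localExcess W s p B ≤ 2 * Fintype.card ι / p := by
  obtain ⟨v, hvp, hv, -⟩ := exists_local_roots s hp hpW
  set m := Fintype.card ι with hm
  have hp0 : (0 : ℝ) < p := by exact_mod_cast hp.pos
  have hle : ∀ B : Finset ι, localExcess W s p B ≤
      (if B = ∅ then (m : ℝ) / p else 0) + (if B ≠ ∅ then localDensity W s p B else 0) := by
    intro B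
    by_cases hB : B = ∅
    · rw [if_pos hB, if_neg (not_not.2 hB), add_zero, hB, localExcess, bernoulliWeight_empty, ← hm]
      have h1 := bernoulli_pow_ge hp m
      have h2 : localDensity W s p ∅ ≤ 1 := by
        rw [localDensity, div_le_one hp0]
        exact_mod_cast (card_filter_le _ _).trans (card_range p).le
      exact max_le (by positivity) (by linarith)
    · rw [if_neg hB, if_pos hB, zero_add]
      refine max_le (localDensity_nonneg _ _ _ _) ?_
      linarith [bernoulliWeight_nonneg hp.one_le B]
  refine (Finset.sum_le_sum fun B _ => hle B).trans ?_
  rw [Finset.sum_add_distrib, Finset.sum_ite_eq' univ, if_pos (mem_univ _), ← Finset.sum_filter]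
  have h3 : ∑ B : Finset ι with B ≠ ∅, localDensity W s p B ≤ m / p := by
    simp_rw [localDensity]
    rw [← Finset.sum_div]
    refine div_le_div_of_nonneg_right ?_ hp0.le
    have hsub : ∀ B ∈ ({B | B ≠ ∅} : Finset (Finset ι)),
        ({a ∈ Finset.range p | localState W s p (a : ℕ) = B} : Finset ℕ) =
        {a ∈ (univ.image v) | localState W s p (a : ℕ) = B} := by
      intro B hB
      ext a
      simp only [mem_filter, Finset.mem_range, mem_image, mem_univ, true_and]
      constructor
      · rintro ⟨ha, h⟩
        obtain ⟨i, hi⟩ := nonempty_iff_ne_empty.2 (mem_filter.1 hB).2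
        refine ⟨⟨i, ?_⟩, h⟩
        rw [← h, hv] at hi
        exact (Nat.ModEq.eq_of_lt_of_lt (Int.natCast_modEq_iff.1 hi) ha (hvp i)).symm
      · rintro ⟨⟨i, rfl⟩, h⟩
        exact ⟨hvp i, h⟩
    have h4 : ∑ B : Finset ι with B ≠ ∅,
        #{a ∈ Finset.range p | localState W s p (a : ℕ) = B} ≤ m := by
      rw [Finset.sum_congr rfl fun B hB => congrArg card (hsub B hB)]
      rw [Finset.sum_card_fiberwise_eq_card_filter]
      exact (card_filter_le _ _).trans (card_image_le.trans card_univ.le)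
    exact_mod_cast h4
  refine (add_le_add le_rfl h3).trans (le_of_eq ?_)
  ring

lemma sum_localExcess_le_of_injective {ι : Type*} [Fintype ι] {W : ℕ} (s : ι → ℤ) {p : ℕ}
    (hp : p.Prime) (hpW : ¬ p ∣ W) (hs : ∀ i j, i ≠ j → ¬ (p : ℤ) ∣ s i - s j) :
    ∑ B : Finset ι, localExcess W s p B ≤ (Fintype.card ι : ℝ) ^ 2 / (p : ℝ) ^ 2 := by
  obtain ⟨v, hvp, hv, hvs⟩ := exists_local_roots s hp hpW
  have hinj : Function.Injective v := fun i j hij => by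
    by_contra h
    exact hs i j h (hvs i j hij)
  set m := Fintype.card ι with hm
  have hp0 : (0 : ℝ) < p := by exact_mod_cast hp.pos
  have hroot : ∀ (a : ℕ) i, a < p → i ∈ localState W s p (a : ℕ) → a = v i := by
    intro a i ha hi
    rw [hv] at hi
    exact Nat.ModEq.eq_of_lt_of_lt (Int.natCast_modEq_iff.1 hi) ha (hvp i)
  have hle : ∀ B : Finset ι, localExcess W s p B ≤
      ∑ i, if B = {i} then (m : ℝ) / (p : ℝ) ^ 2 else 0 := by
    intro B
    have hnn : 0 ≤ ∑ i, if B = {i} then (m : ℝ) / (p : ℝ) ^ 2 else 0 :=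
      Finset.sum_nonneg fun i _ => by split_ifs <;> positivity
    refine max_le hnn ?_
    rcases B.eq_empty_or_nonempty with hB | ⟨i, hi⟩
    · refine le_trans ?_ hnn
      rw [hB, bernoulliWeight_empty, ← hm]
      have h1 := bernoulli_pow_ge hp m
      have h2 : #{a ∈ Finset.range p | localState W s p (a : ℕ) = ∅} ≤ p - m := by
        have : ({a ∈ Finset.range p | localState W s p (a : ℕ) = ∅} : Finset ℕ) ⊆
            Finset.range p \ univ.image v := by
          intro a ha
          rw [mem_filter] at ha
          refine mem_sdiff.2 ⟨ha.1, fun h => ?_⟩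
          obtain ⟨i, -, rfl⟩ := mem_image.1 h
          have : i ∈ localState W s p (v i : ℕ) := (hv i _).2 rfl
          rw [ha.2] at this
          exact notMem_empty _ this
        refine (card_le_card this).trans ?_
        rw [card_sdiff_of_subset, card_range, card_image_of_injective _ hinj, card_univ]
        intro a ha
        obtain ⟨i, -, rfl⟩ := mem_image.1 ha
        exact Finset.mem_range.2 (hvp i)
      have hmp : m ≤ p := by
        have := card_le_card (s := univ.image v) (t := Finset.range p) fun a ha => by
          obtain ⟨i, -, rfl⟩ := mem_image.1 ha
          exact Finset.mem_range.2 (hvp i)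
        rwa [card_range, card_image_of_injective _ hinj, card_univ] at this
      have h3 : localDensity W s p ∅ ≤ 1 - m / p := by
        rw [localDensity, div_le_iff₀ hp0, sub_mul, div_mul_cancel₀ _ hp0.ne', one_mul,
          ← Nat.cast_sub hmp]
        exact_mod_cast h2
      linarith
    · by_cases hBi : B = {i}
      · refine le_trans ?_ (Finset.single_le_sum (f := fun i => if B = {i} then
          (m : ℝ) / (p : ℝ) ^ 2 else 0) (fun i _ => by positivity) (mem_univ i))
        simp only [if_pos hBi]
        have h1 : localDensity W s p B ≤ (p : ℝ)⁻¹ := by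
          rw [localDensity, ← one_div]
          refine div_le_div_of_nonneg_right ?_ hp0.le
          have : ({a ∈ Finset.range p | localState W s p (a : ℕ) = B} : Finset ℕ) ⊆ {v i} := by
            intro a ha
            rw [mem_filter, Finset.mem_range] at ha
            exact Finset.mem_singleton.2 (hroot a i ha.1 (ha.2 ▸ hi))
          exact_mod_cast card_le_card this
        have h2 : (p : ℝ)⁻¹ * (1 - m / p) ≤ bernoulliWeight p B := by
          rw [bernoulliWeight, hBi, Finset.prod_singleton, Finset.prod_const]
          refine mul_le_mul_of_nonneg_left ?_ (by positivity)
          have hq : (p : ℝ)⁻¹ ≤ 1 := inv_le_one_of_one_le₀ (by exact_mod_cast hp.one_le)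
          refine (bernoulli_pow_ge hp m).trans (pow_le_pow_of_le_one (by linarith)
            (by linarith [inv_pos.2 hp0]) ?_)
          exact card_le_univ _
        calc localDensity W s p B - bernoulliWeight p B
            ≤ (p : ℝ)⁻¹ - (p : ℝ)⁻¹ * (1 - m / p) := by linarith
          _ = m / (p : ℝ) ^ 2 := by field_simp; ring
      · refine le_trans ?_ hnn
        have : #{a ∈ Finset.range p | localState W s p (a : ℕ) = B} = 0 := by
          refine card_eq_zero.2 (filter_eq_empty_iff.2 fun a ha h => hBi ?_)
          have ha := Finset.mem_range.1 ha
          refine eq_singleton_iff_unique_mem.2 ⟨hi, fun j hj => hinj ?_⟩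
          rw [← hroot a i ha (h ▸ hi), ← hroot a j ha (h ▸ hj)]
        rw [localDensity, this]
        have := bernoulliWeight_nonneg hp.one_le B
        simpa using this
  refine (Finset.sum_le_sum fun B _ => hle B).trans ?_
  rw [Finset.sum_comm]
  simp_rw [Finset.sum_ite_eq', mem_univ, if_true]
  rw [Finset.sum_const, card_univ, ← hm, nsmul_eq_mul]
  exact le_of_eq (by ring)

lemma abs_card_residue_sub_le (a : ℤ) (M : ℕ) {q : ℕ} (hq : 0 < q) (v : ℤ) :
    |(#{x ∈ Ico a (a + M) | x ≡ v [ZMOD q]} : ℝ) - M / q| ≤ 1 := by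
  have hq' : (0 : ℤ) < q := by exact_mod_cast hq
  have h := Int.Ico_filter_modEq_card a (a + M) hq' v
  have hq0 : (0 : ℚ) < ((q : ℤ) : ℚ) := by exact_mod_cast hq
  set x : ℚ := ((a + M : ℤ) - (v : ℚ)) / ((q : ℤ) : ℚ) with hx
  set y : ℚ := ((a : ℤ) - (v : ℚ)) / ((q : ℤ) : ℚ) with hy
  have hxy : x - y = M / q := by rw [hx, hy]; push_cast; field_simp; ring
  have hle : y ≤ x := by rw [← sub_nonneg, hxy]; positivity
  rw [max_eq_left (sub_nonneg.2 (Int.ceil_le_ceil hle))] at h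
  have h1 := Int.le_ceil x
  have h2 := Int.ceil_lt_add_one x
  have h3 := Int.le_ceil y
  have h4 := Int.ceil_lt_add_one y
  have h5 : ((#{x ∈ Ico a (a + M) | x ≡ v [ZMOD q]} : ℤ) : ℚ) = ⌈x⌉ - ⌈y⌉ := by
    rw [h]; push_cast; rfl
  have h6 : |(#{x ∈ Ico a (a + M) | x ≡ v [ZMOD q]} : ℚ) - M / q| ≤ 1 := by
    push_cast at h5
    rw [h5, ← hxy, abs_le]
    constructor <;> linarith
  have h7 := (Rat.cast_le (K := ℝ)).2 h6
  push_cast at h7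
  exact h7

lemma local_condition {ι : Type*} [Fintype ι] {W : ℕ} (s : ι → ℤ) {p : ℕ} (hp : p.Prime)
    (hpW : ¬ p ∣ W) (T : Finset ι) :
    ((∀ a : ℤ, ¬ T ⊆ localState W s p a) ∧
      (#{a ∈ Finset.range p | T ⊆ localState W s p (a : ℕ)} : ℝ) / p = 0) ∨
    ∃ u q : ℕ, (q = 1 ∨ q = p) ∧ (∀ a : ℤ, T ⊆ localState W s p a ↔ a ≡ u [ZMOD q]) ∧
      (#{a ∈ Finset.range p | T ⊆ localState W s p (a : ℕ)} : ℝ) / p = (q : ℝ)⁻¹ := by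
  obtain ⟨v, hvp, hv, -⟩ := exists_local_roots s hp hpW
  have hp0 : (p : ℝ) ≠ 0 := by exact_mod_cast hp.ne_zero
  rcases T.eq_empty_or_nonempty with rfl | ⟨i, hi⟩
  · refine Or.inr ⟨0, 1, Or.inl rfl, fun a => ?_, ?_⟩
    · simp [Int.modEq_one]
    · simp [hp0]
  · by_cases h : ∃ a : ℤ, T ⊆ localState W s p a
    · obtain ⟨a₀, ha₀⟩ := h
      have key : ∀ a : ℤ, T ⊆ localState W s p a ↔ a ≡ v i [ZMOD p] := by
        refine fun a => ⟨fun h => (hv i a).1 (h hi), fun h j hj => (hv j a).2 ?_⟩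
        exact (h.trans ((hv i a₀).1 (ha₀ hi)).symm).trans ((hv j a₀).1 (ha₀ hj))
      refine Or.inr ⟨v i, p, Or.inr rfl, key, ?_⟩
      have : ({a ∈ Finset.range p | T ⊆ localState W s p (a : ℕ)} : Finset ℕ) = {v i} := by
        ext a
        rw [mem_filter, Finset.mem_range, key, Finset.mem_singleton]
        constructor
        · exact fun h => Nat.ModEq.eq_of_lt_of_lt (Int.natCast_modEq_iff.1 h.2) h.1 (hvp i)
        · rintro rfl
          exact ⟨hvp i, rfl⟩
      rw [this, card_singleton, Nat.cast_one, one_div]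
    · rw [not_exists] at h
      refine Or.inl ⟨h, ?_⟩
      have h0 : #{a ∈ Finset.range p | T ⊆ localState W s p (a : ℕ)} = 0 :=
        card_eq_zero.2 (filter_eq_empty_iff.2 fun a _ => h (a : ℕ))
      rw [h0, Nat.cast_zero, zero_div]

lemma abs_card_local_conditions_sub_le {ι : Type*} [Fintype ι] {W : ℕ} (s : ι → ℤ) (P : Finset ℕ)
    (hP : ∀ p ∈ P, p.Prime) (hPW : ∀ p ∈ P, ¬ p ∣ W) (T : ℕ → Finset ι) (a : ℤ) (M : ℕ) :
    |(#{n ∈ Ico a (a + M) | ∀ p ∈ P, T p ⊆ localState W s p n} : ℝ) -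
      M * ∏ p ∈ P, ((#{b ∈ Finset.range p | T p ⊆ localState W s p (b : ℕ)} : ℝ) / p)| ≤ 1 := by
  by_cases hex : ∃ p ∈ P, ∀ b : ℤ, ¬ T p ⊆ localState W s p b
  · obtain ⟨p, hp, hb⟩ := hex
    have h1 : #{n ∈ Ico a (a + M) | ∀ p ∈ P, T p ⊆ localState W s p n} = 0 :=
      card_eq_zero.2 (filter_eq_empty_iff.2 fun n _ h => hb n (h p hp))
    have h2 : (#{b ∈ Finset.range p | T p ⊆ localState W s p (b : ℕ)} : ℝ) / p = 0 := by
      have h0 : #{b ∈ Finset.range p | T p ⊆ localState W s p (b : ℕ)} = 0 :=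
        card_eq_zero.2 (filter_eq_empty_iff.2 fun n _ => hb (n : ℕ))
      rw [h0, Nat.cast_zero, zero_div]
    rw [h1, Finset.prod_eq_zero hp h2]
    simp
  · push Not at hex
    have hloc : ∀ p, ∃ u q : ℕ, p ∈ P → (q = 1 ∨ q = p) ∧
        (∀ b : ℤ, T p ⊆ localState W s p b ↔ b ≡ u [ZMOD q]) ∧
        (#{b ∈ Finset.range p | T p ⊆ localState W s p (b : ℕ)} : ℝ) / p = (q : ℝ)⁻¹ := by
      intro p
      by_cases hp : p ∈ P
      · rcases local_condition s (hP p hp) (hPW p hp) (T p) with h | ⟨u, q, h⟩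
        · obtain ⟨b, hb⟩ := hex p hp
          exact absurd hb (h.1 b)
        · exact ⟨u, q, fun _ => h⟩
      · exact ⟨0, 0, fun h => absurd h hp⟩
    choose u q huq using hloc
    have hq0 : ∀ p ∈ P, q p ≠ 0 := fun p hp => by
      rcases (huq p hp).1 with h | h <;> rw [h]
      · exact one_ne_zero
      · exact (hP p hp).ne_zero
    have hcop : ∀ p ∈ P, ∀ p' ∈ P, p ≠ p' → Nat.Coprime (q p) (q p') := by
      intro p hp p' hp' hne
      rcases (huq p hp).1 with h | h <;> rw [h]
      · exact Nat.coprime_one_left _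
      · rcases (huq p' hp').1 with h' | h' <;> rw [h']
        · exact Nat.coprime_one_right _
        · exact (Nat.coprime_primes (hP p hp) (hP p' hp')).2 hne
    obtain ⟨n₀, hn₀⟩ := Nat.chineseRemainderOfFinset u q P hq0
      (fun p hp p' hp' hne => hcop p hp p' hp' hne)
    have hset : ∀ n : ℤ, (∀ p ∈ P, T p ⊆ localState W s p n) ↔
        n ≡ n₀ [ZMOD (∏ p ∈ P, q p : ℕ)] := by
      intro n
      constructor
      · intro h
        rw [Int.modEq_comm, Int.modEq_iff_dvd]
        push_cast
        refine Finset.prod_dvd_of_coprime (fun p hp p' hp' hne =>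
          Nat.isCoprime_iff_coprime.2 (hcop p hp p' hp' hne)) fun p hp => ?_
        have h1 := ((huq p hp).2.1 n).1 (h p hp)
        exact ((Int.natCast_modEq_iff.2 (hn₀ p hp)).trans h1.symm).dvd
      · intro h p hp
        refine ((huq p hp).2.1 n).2 ?_
        have h1 : (q p : ℤ) ∣ ((∏ p ∈ P, q p : ℕ) : ℤ) := by
          exact_mod_cast Finset.dvd_prod_of_mem q hp
        exact (h.of_dvd h1).trans (Int.natCast_modEq_iff.2 (hn₀ p hp))
    simp_rw [hset]
    rw [Finset.prod_congr rfl fun p hp => (huq p hp).2.2, Finset.prod_inv_distrib,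
      ← div_eq_mul_inv, ← Nat.cast_prod]
    exact abs_card_residue_sub_le a M (Nat.pos_of_ne_zero (Finset.prod_ne_zero_iff.2 hq0)) n₀

lemma sum_abs_sieveWeight_le {R : ℝ} (hR : 0 ≤ R) (P : Finset ℕ) (hP : ∀ p ∈ P, p.Prime) :
    ∑ D ∈ P.powerset, |sieveWeight R D| ≤ R ^ 2 := by
  set T : Finset ℕ := {n ∈ Icc 1 ⌊R⌋₊ | Squarefree n ∧ n.primeFactors ⊆ P} with hT
  have h := sum_powerset_primes P hP T (fun d => Real.posLog (R / d)) ?_ ?_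
  · have e : ∀ D ∈ P.powerset, |sieveWeight R D| = Real.posLog (R / (∏ p ∈ D, p : ℕ)) := by
      intro D _
      rw [sieveWeight, abs_mul, abs_pow, abs_neg, abs_one, one_pow, one_mul,
        abs_of_nonneg Real.posLog_nonneg]
      push_cast
      rfl
    rw [Finset.sum_congr rfl e, h]
    have h1 : ∀ d ∈ T, Real.posLog (R / d) ≤ R := by
      intro d hd
      have hd1 : (1 : ℝ) ≤ d := by exact_mod_cast (mem_Icc.1 (mem_filter.1 hd).1).1
      have h2 : R / d ≤ R := div_le_self hR hd1
      have h3 : 0 ≤ R / d := by positivity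
      exact max_le hR ((Real.log_le_self h3).trans h2)
    refine (Finset.sum_le_card_nsmul _ _ _ h1).trans ?_
    rw [nsmul_eq_mul, sq]
    refine mul_le_mul_of_nonneg_right ?_ hR
    have h2 : #T ≤ ⌊R⌋₊ := (card_filter_le _ _).trans (by simp)
    exact (Nat.cast_le.2 h2).trans (Nat.floor_le hR)
  · intro d hd hsub hne
    have hd0 := Nat.pos_of_ne_zero hd.ne_zero
    refine mem_filter.2 ⟨mem_Icc.2 ⟨hd0, Nat.le_floor ?_⟩, hd, hsub⟩
    have hd0' : (0 : ℝ) < d := by exact_mod_cast hd0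
    by_contra! hlt
    exact hne (posLog_eq_zero_of_lt (by positivity) ((div_le_one hd0').2 hlt.le))
  · intro d hd _
    exact (mem_filter.1 hd).2

/-- The primes of `P` dividing `W n + 1`. -/
def sievedPrimes (W : ℕ) (P : Finset ℕ) (n : ℤ) : Finset ℕ := {p ∈ P | (p : ℤ) ∣ W * n + 1}

lemma sum_sieveSum_sq_le {ι : Type*} [Fintype ι] {R : ℝ} (hR : 0 ≤ R) {W : ℕ} (s : ι → ℤ)
    (P : Finset ℕ) (hP : ∀ p ∈ P, p.Prime) (hPW : ∀ p ∈ P, ¬ p ∣ W) (a : ℤ) (M : ℕ) :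
    ∑ n ∈ Ico a (a + M), ∏ i, sieveSum R (sievedPrimes W P (n + s i)) ^ 2 ≤
      M * ∑ σ : P → Finset ι, (∏ p : P, localDensity W s p (σ p)) *
        ∏ i, sieveSum R (attachedPrimes σ i) ^ 2 + R ^ (4 * Fintype.card ι) := by
  have hZ : ∀ n i, sievedPrimes W P (n + s i) = sievedPrimes W P (n + s i) ∩ P := fun n i =>
    (inter_eq_left.2 (filter_subset _ _)).symm
  have hZ' : ∀ (σ : P → Finset ι) i, attachedPrimes σ i = attachedPrimes σ i ∩ P := fun σ i =>
    (inter_eq_left.2 (filter_subset _ _)).symm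
  have e1 : ∑ n ∈ Ico a (a + M), ∏ i, sieveSum R (sievedPrimes W P (n + s i)) ^ 2 =
      ∑ x ∈ Fintype.piFinset fun _ : ι => P.powerset ×ˢ P.powerset,
        (∏ i, sieveWeight R (x i).1 * sieveWeight R (x i).2) *
        (#{n ∈ Ico a (a + M) | ∀ p ∈ P, (univ.filter fun i => p ∈ (x i).1 ∪ (x i).2) ⊆
          localState W s p n} : ℝ) := by
    rw [Finset.sum_congr rfl fun n _ => Finset.prod_congr rfl fun i _ => by rw [hZ]]
    rw [Finset.sum_congr rfl fun n _ => prod_sieveSum_sq (fun _ => R) P _, Finset.sum_comm]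
    refine Finset.sum_congr rfl fun x hx => ?_
    rw [← Finset.mul_sum, card_filter]
    push_cast
    congr 1
    refine Finset.sum_congr rfl fun n _ => ?_
    rw [prod_indicator_eq]
    refine if_congr ?_ rfl rfl
    constructor
    · intro h p hp i hi
      exact mem_filter.2 ⟨mem_univ _, (mem_filter.1 (h i (mem_filter.1 hi).2)).2⟩
    · intro h i p hp
      have hx' := mem_product.1 (Fintype.mem_piFinset.1 hx i)
      have hpP : p ∈ P := union_subset (mem_powerset.1 hx'.1) (mem_powerset.1 hx'.2) hp
      exact mem_filter.2 ⟨hpP, (mem_filter.1 (h p hpP (mem_filter.2 ⟨mem_univ i, hp⟩))).2⟩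
  have e2 : ∑ σ : P → Finset ι, (∏ p : P, localDensity W s p (σ p)) *
        ∏ i, sieveSum R (attachedPrimes σ i) ^ 2 =
      ∑ x ∈ Fintype.piFinset fun _ : ι => P.powerset ×ˢ P.powerset,
        (∏ i, sieveWeight R (x i).1 * sieveWeight R (x i).2) *
        ∏ p ∈ P, ((#{b ∈ Finset.range p | (univ.filter fun i => p ∈ (x i).1 ∪ (x i).2) ⊆
          localState W s p (b : ℕ)} : ℝ) / p) := by
    have e0 : ∀ σ : P → Finset ι, ∏ i, sieveSum R (attachedPrimes σ i) ^ 2 =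
        ∏ i, sieveSum R (attachedPrimes σ i ∩ P) ^ 2 := fun σ =>
      Finset.prod_congr rfl fun i _ => by rw [← hZ' σ i]
    rw [Finset.sum_congr rfl fun σ _ => congrArg _ (e0 σ)]
    rw [sum_config_sieve (fun _ => R) P P le_rfl fun p B => localDensity W s p B]
    simp_rw [sum_localDensity_superset]
  have hbound : ∀ x ∈ Fintype.piFinset fun _ : ι => P.powerset ×ˢ P.powerset,
      (∏ i, sieveWeight R (x i).1 * sieveWeight R (x i).2) *
        (#{n ∈ Ico a (a + M) | ∀ p ∈ P, (univ.filter fun i => p ∈ (x i).1 ∪ (x i).2) ⊆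
          localState W s p n} : ℝ) ≤
      M * ((∏ i, sieveWeight R (x i).1 * sieveWeight R (x i).2) *
        ∏ p ∈ P, ((#{b ∈ Finset.range p | (univ.filter fun i => p ∈ (x i).1 ∪ (x i).2) ⊆
          localState W s p (b : ℕ)} : ℝ) / p)) +
      ∏ i, |sieveWeight R (x i).1| * |sieveWeight R (x i).2| := by
    intro x _
    have h := abs_card_local_conditions_sub_le s P hP hPW
      (fun p => univ.filter fun i => p ∈ (x i).1 ∪ (x i).2) a M
    set c := ∏ i, sieveWeight R (x i).1 * sieveWeight R (x i).2 with hc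
    have hc' : ∏ i, |sieveWeight R (x i).1| * |sieveWeight R (x i).2| = |c| := by
      rw [hc, Finset.abs_prod]
      exact Finset.prod_congr rfl fun i _ => (abs_mul _ _).symm
    rw [hc', ← sub_le_iff_le_add']
    refine le_trans (le_of_eq ?_) ((le_abs_self _).trans ((abs_mul c _).le.trans
      (mul_le_of_le_one_right (abs_nonneg c) h)))
    ring
  rw [e1, e2, Finset.mul_sum]
  refine (Finset.sum_le_sum hbound).trans ?_
  rw [Finset.sum_add_distrib]
  refine add_le_add le_rfl ?_
  rw [← Finset.prod_univ_sum (fun _ : ι => P.powerset ×ˢ P.powerset)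
    (fun _ x => |sieveWeight R x.1| * |sieveWeight R x.2|), Finset.prod_const, card_univ]
  have h1 := sum_abs_sieveWeight_le hR P hP
  have h2 : ∑ x ∈ P.powerset ×ˢ P.powerset, |sieveWeight R x.1| * |sieveWeight R x.2| ≤ R ^ 4 := by
    rw [Finset.sum_product]
    dsimp only
    rw [← Finset.sum_mul_sum, ← sq]
    refine (pow_le_pow_left₀ (Finset.sum_nonneg fun _ _ => abs_nonneg _) h1 2).trans (le_of_eq ?_)
    ring
  rw [pow_mul]
  exact pow_le_pow_left₀ (Finset.sum_nonneg fun _ _ => by positivity) h2 _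

/-- The product of `1 + c / p` over the primes `p` dividing `a`. -/
def primeFactorProd (c : ℝ) (a : ℕ) : ℝ := ∏ p ∈ a.primeFactors, (1 + c / p)

lemma one_le_primeFactorProd {c : ℝ} (hc : 0 ≤ c) (a : ℕ) : 1 ≤ primeFactorProd c a :=
  Finset.one_le_prod fun p _ => le_add_of_nonneg_right (by positivity)

lemma localExcess_factor_le {ι : Type*} [Fintype ι] {W : ℕ} (s : ι → ℤ) {p : ℕ} (hp : p.Prime)
    (hpW : ¬ p ∣ W) {A : ℝ} (hA : 0 ≤ A) :
    1 + A * ∑ B, localExcess W s p B ≤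
      (1 + A * (Fintype.card ι : ℝ) ^ 2 * ((p : ℝ) * ((p : ℝ) - 1))⁻¹) *
      ∏ x ∈ (univ : Finset ι).offDiag,
        (if (p : ℤ) ∣ s x.1 - s x.2 then 1 + A * (2 * Fintype.card ι) / p else 1) := by
  have hp1 : (1 : ℝ) < p := by exact_mod_cast hp.one_lt
  have hpp : 0 < (p : ℝ) * ((p : ℝ) - 1) := mul_pos (by linarith) (by linarith)
  have h1 : 1 ≤ 1 + A * (Fintype.card ι : ℝ) ^ 2 * ((p : ℝ) * ((p : ℝ) - 1))⁻¹ :=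
    le_add_of_nonneg_right (by positivity)
  have h2 : ∀ x : ι × ι, 1 ≤ (if (p : ℤ) ∣ s x.1 - s x.2 then
      1 + A * (2 * Fintype.card ι) / p else 1) := by
    intro x
    split_ifs
    · exact le_add_of_nonneg_right (by positivity)
    · exact le_rfl
  by_cases h : ∃ i j, i ≠ j ∧ (p : ℤ) ∣ s i - s j
  · obtain ⟨i, j, hij, hd⟩ := h
    have h3 := Finset.prod_le_prod_of_subset_of_one_le (s := {(i, j)})
      (t := (univ : Finset ι).offDiag) (f := fun x : ι × ι => (if (p : ℤ) ∣ s x.1 - s x.2 then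
      1 + A * (2 * Fintype.card ι) / p else 1)) (by simp [hij]) (by simp [hd]; positivity)
      (fun x _ _ => h2 x)
    simp only [Finset.prod_singleton, if_pos hd] at h3
    refine le_trans ?_ (le_mul_of_one_le_left (zero_le_one.trans
      (Finset.one_le_prod fun x _ => h2 x)) h1)
    refine le_trans ?_ h3
    rw [mul_div_assoc]
    gcongr
    exact sum_localExcess_le s hp hpW
  · push Not at h
    have h3 := sum_localExcess_le_of_injective s hp hpW h
    have h4 : (Fintype.card ι : ℝ) ^ 2 / p ^ 2 ≤
        (Fintype.card ι : ℝ) ^ 2 * ((p : ℝ) * ((p : ℝ) - 1))⁻¹ := by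
      rw [div_eq_mul_inv]
      gcongr
      nlinarith
    refine le_trans ?_ (le_mul_of_one_le_right (by linarith) (Finset.one_le_prod fun x _ => h2 x))
    rw [mul_assoc]
    gcongr
    exact h3.trans h4


lemma prod_localExcess_le {ι : Type*} [Fintype ι] {W : ℕ} {s : ι → ℤ} (hs : Function.Injective s)
    {P : Finset ℕ} (hP : ∀ p ∈ P, p.Prime) (hPW : ∀ p ∈ P, ¬ p ∣ W) {A : ℝ} (hA : 0 ≤ A) :
    ∏ p ∈ P, (1 + A * ∑ B, localExcess W s p B) ≤
      Real.exp (A * (Fintype.card ι : ℝ) ^ 2) *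
      ∏ x ∈ (univ : Finset ι).offDiag,
        primeFactorProd (A * (2 * Fintype.card ι)) (s x.1 - s x.2).natAbs := by
  have hpp : ∀ p ∈ P, 0 ≤ ((p : ℝ) * ((p : ℝ) - 1))⁻¹ := fun p hp => by
    have hp1 : (1 : ℝ) < p := by exact_mod_cast (hP p hp).one_lt
    exact inv_nonneg.2 (mul_nonneg (by linarith) (by linarith))
  refine (Finset.prod_le_prod (fun p hp => ?_) fun p hp =>
    localExcess_factor_le s (hP p hp) (hPW p hp) hA).trans ?_
  · exact add_nonneg zero_le_one (mul_nonneg hA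
      (Finset.sum_nonneg fun B _ => localExcess_nonneg _ _ _ _))
  rw [Finset.prod_mul_distrib, Finset.prod_comm]
  refine mul_le_mul ?_ ?_ ?_ (Real.exp_pos _).le
  · refine (prod_one_add_le_exp _ _ fun p hp => mul_nonneg (by positivity) (hpp p hp)).trans ?_
    rw [Real.exp_le_exp, ← Finset.mul_sum]
    exact mul_le_of_le_one_right (by positivity) (sum_inv_mul_pred_le_one hP)
  · refine Finset.prod_le_prod (fun x _ => Finset.prod_nonneg fun p _ => ?_) fun x hx => ?_
    · split_ifs <;> positivity
    · rw [← Finset.prod_filter]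
      have hx0 : s x.1 - s x.2 ≠ 0 := sub_ne_zero.2 fun h => (mem_offDiag.1 hx).2.2 (hs h)
      refine Finset.prod_le_prod_of_subset_of_one_le (fun p hp => ?_) (fun p _ => by positivity)
        fun p _ _ => le_add_of_nonneg_right (by positivity)
      rw [mem_filter] at hp
      exact Nat.mem_primeFactors.2 ⟨hP p hp.1, Int.natCast_dvd.1 hp.2, Int.natAbs_ne_zero.2 hx0⟩
  · exact Finset.prod_nonneg fun x _ => Finset.prod_nonneg fun p _ => by split_ifs <;> positivity

lemma sum_sieveSum_sq_le_of_injective {ι : Type*} [Fintype ι] {R : ℝ} (hR : 0 ≤ R)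
    {L : ℝ} (hL : 1 ≤ L) (hRL : Real.log R ≤ L) {K : ℕ} (hK : R ≤ K) {W : ℕ} (hW : 0 < W)
    (hWL : W * (1 + Real.log W) ≤ L) {s : ι → ℤ} (hs : Function.Injective s) (a : ℤ) (M : ℕ) :
    ∑ n ∈ Ico a (a + M), ∏ i, sieveSum R
        (sievedPrimes W (primesAvoiding K W.primeFactors) (n + s i)) ^ 2 ≤
      M * ((225 * ((W : ℝ) / Nat.totient W * L)) ^ Fintype.card ι *
        (Real.exp (16 ^ Fintype.card ι * (Fintype.card ι : ℝ) ^ 2) *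
        ∏ x ∈ (univ : Finset ι).offDiag,
          primeFactorProd (16 ^ Fintype.card ι * (2 * Fintype.card ι)) (s x.1 - s x.2).natAbs)) +
      R ^ (4 * Fintype.card ι) := by
  set P := primesAvoiding K W.primeFactors with hPdef
  have hP : ∀ p ∈ P, p.Prime := fun p hp => (mem_primesAvoiding.1 hp).2.1
  have hPW : ∀ p ∈ P, ¬ p ∣ W := fun p hp h =>
    (mem_primesAvoiding.1 hp).2.2 (Nat.mem_primeFactors.2 ⟨hP p hp, h, hW.ne'⟩)
  have hV : ∀ f ⊆ P, ∀ R' : ℝ, 0 ≤ R' → R' ≤ R → selbergForm R' (P \ f) ≤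
      225 * ((W : ℝ) / Nat.totient W * L) * 4 ^ #f := by
    intro f hf R' hR' hle
    have e : P \ f = primesAvoiding K (W.primeFactors ∪ f) := by
      ext p
      rw [Finset.mem_sdiff, mem_primesAvoiding, mem_primesAvoiding, Finset.mem_union]
      tauto
    rw [e]
    refine selbergForm_le hR' (hle.trans hK) hW (fun p hp => hP p (hf hp)) hL ?_ hWL
    rcases Nat.eq_zero_or_pos ⌊R'⌋₊ with h | h
    · rw [h, Nat.cast_zero, Real.log_zero]
      linarith
    · exact (Real.log_le_log (Nat.cast_pos.2 h) ((Nat.floor_le hR').trans hle)).trans hRL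
  have h1 := sum_config_sieve_le hR hP hV (localDensity W s) (localExcess W s)
    (fun p _ B => localDensity_nonneg _ _ _ _) (fun p _ B => localExcess_nonneg _ _ _ _)
    (fun p _ B => localDensity_le W s p B)
  have h2 := prod_localExcess_le hs hP hPW (A := 16 ^ Fintype.card ι) (by positivity)
  have h3 : 0 ≤ (225 * ((W : ℝ) / Nat.totient W * L)) ^ Fintype.card ι := by positivity
  exact (sum_sieveSum_sq_le hR s P hP hPW a M).trans (add_le_add_left
    (mul_le_mul_of_nonneg_left (h1.trans (mul_le_mul_of_nonneg_left h2 h3)) M.cast_nonneg) _)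

lemma primeFactorProd_pos {c : ℝ} (hc : 0 ≤ c) (a : ℕ) : 0 < primeFactorProd c a :=
  zero_lt_one.trans_le (one_le_primeFactorProd hc a)

lemma primeFactorProd_mono {c c' : ℝ} (hc : 0 ≤ c) (hcc : c ≤ c') (a : ℕ) :
    primeFactorProd c a ≤ primeFactorProd c' a :=
  Finset.prod_le_prod (fun p _ => by positivity) fun p _ => by gcongr

lemma one_add_mul_pow_le {c x : ℝ} (hc : 0 ≤ c) (hx : 0 ≤ x) (hx1 : x ≤ 1) (E : ℕ) :
    (1 + c * x) ^ E ≤ 1 + ((1 + c) ^ E - 1) * x := by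
  induction E with
  | zero => simp
  | succ E ih =>
    have hD : 1 ≤ (1 + c) ^ E := one_le_pow₀ (by linarith)
    have hxx : x * x ≤ x := mul_le_of_le_one_left hx hx1
    rw [pow_succ]
    refine (mul_le_mul_of_nonneg_right ih (by positivity)).trans ?_
    rw [pow_succ]
    nlinarith [mul_le_mul_of_nonneg_left hxx (mul_nonneg hc (sub_nonneg.2 hD))]

lemma primeFactorProd_pow_le {c : ℝ} (hc : 0 ≤ c) (E a : ℕ) :
    primeFactorProd c a ^ E ≤ primeFactorProd ((1 + c) ^ E) a := by
  rw [primeFactorProd, ← Finset.prod_pow]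
  refine Finset.prod_le_prod (fun p _ => by positivity) fun p hp => ?_
  have hp1 : (1 : ℝ) ≤ p := by exact_mod_cast (Nat.prime_of_mem_primeFactors hp).one_lt.le
  have h := one_add_mul_pow_le hc (inv_nonneg.2 (zero_le_one.trans hp1))
    (inv_le_one_of_one_le₀ hp1) E
  rw [div_eq_mul_inv, div_eq_mul_inv]
  refine h.trans ?_
  gcongr
  linarith

lemma sum_primeFactorProd_le {c : ℝ} (hc : 0 ≤ c) (M : ℕ) :
    ∑ v ∈ Ioc 0 M, primeFactorProd c v ≤ Real.exp c * M := by
  set P : Finset ℕ := {p ∈ Finset.range (M + 1) | p.Prime} with hPdef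
  have hP : ∀ p ∈ P, p.Prime := fun p hp => (mem_filter.1 hp).2
  have hsub : ∀ v ∈ Ioc 0 M, v.primeFactors = {p ∈ P | p ∣ v} := by
    intro v hv
    rw [mem_Ioc] at hv
    ext p
    rw [Nat.mem_primeFactors, mem_filter, hPdef, mem_filter, Finset.mem_range]
    constructor
    · rintro ⟨h1, h2, h3⟩
      exact ⟨⟨by have := Nat.le_of_dvd hv.1 h2; omega, h1⟩, h2⟩
    · rintro ⟨⟨h1, h2⟩, h3⟩
      exact ⟨h2, h3, hv.1.ne'⟩
  have h1 : ∀ v ∈ Ioc 0 M, primeFactorProd c v =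
      ∑ D ∈ P.powerset, if ∏ p ∈ D, p ∣ v then ∏ p ∈ D, c / (p : ℝ) else 0 := by
    intro v hv
    rw [primeFactorProd, hsub v hv, Finset.prod_one_add, ← Finset.sum_filter]
    refine Finset.sum_congr ?_ fun _ _ => rfl
    ext D
    rw [mem_powerset, mem_filter, mem_powerset]
    constructor
    · intro h
      refine ⟨fun p hp => (mem_filter.1 (h hp)).1, ?_⟩
      exact Finset.prod_primes_dvd v (fun p hp => (hP p (mem_filter.1 (h hp)).1).prime)
        fun p hp => (mem_filter.1 (h hp)).2
    · rintro ⟨h, h'⟩ p hp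
      exact mem_filter.2 ⟨h hp, (Finset.dvd_prod_of_mem _ hp).trans h'⟩
  rw [Finset.sum_congr rfl h1, Finset.sum_comm]
  have h2 : ∀ D ∈ P.powerset,
      (∑ v ∈ Ioc 0 M, if ∏ p ∈ D, p ∣ v then ∏ p ∈ D, c / (p : ℝ) else 0) ≤
        (∏ p ∈ D, c / (p : ℝ) ^ 2) * M := by
    intro D hD
    rw [← Finset.sum_filter, Finset.sum_const, Nat.Ioc_filter_dvd_card_eq_div, nsmul_eq_mul]
    calc ((M / ∏ p ∈ D, p : ℕ) : ℝ) * ∏ p ∈ D, c / (p : ℝ)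
        ≤ ((M : ℝ) / (∏ p ∈ D, p : ℕ)) * ∏ p ∈ D, c / (p : ℝ) :=
          mul_le_mul_of_nonneg_right Nat.cast_div_le (Finset.prod_nonneg fun p _ => by positivity)
      _ = _ := by
          push_cast
          rw [Finset.prod_div_distrib, Finset.prod_div_distrib, Finset.prod_pow]
          field_simp
  refine (Finset.sum_le_sum h2).trans ?_
  rw [← Finset.sum_mul, ← Finset.prod_one_add]
  refine mul_le_mul_of_nonneg_right ?_ M.cast_nonneg
  refine (prod_one_add_le_exp _ _ fun p _ => by positivity).trans (Real.exp_le_exp.2 ?_)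
  calc ∑ p ∈ P, c / (p : ℝ) ^ 2 ≤ ∑ p ∈ P, c * ((p : ℝ) * ((p : ℝ) - 1))⁻¹ := by
        refine Finset.sum_le_sum fun p hp => ?_
        have hp1 : (1 : ℝ) < p := by exact_mod_cast (hP p hp).one_lt
        have hpp : 0 < (p : ℝ) * ((p : ℝ) - 1) := mul_pos (by linarith) (by linarith)
        rw [div_eq_mul_inv]
        gcongr
        nlinarith
    _ ≤ c := by
        rw [← Finset.mul_sum]
        exact mul_le_of_le_one_right hc (sum_inv_mul_pred_le_one hP)

lemma two_pow_card_primeFactors_le {δ : ℝ} (hδ : 0 < δ) :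
    ∃ C : ℝ, 0 < C ∧ ∀ n : ℕ, 0 < n → (2 : ℝ) ^ #n.primeFactors ≤ C * (n : ℝ) ^ δ := by
  obtain ⟨B, hB⟩ := exists_nat_gt ((2 : ℝ) ^ δ⁻¹)
  refine ⟨2 ^ B, by positivity, fun n hn => ?_⟩
  have h1 : ∀ p ∈ n.primeFactors, (2 : ℝ) ≤ (if p < B then 2 else 1) * (p : ℝ) ^ δ := by
    intro p hp
    have hp1 : (1 : ℝ) ≤ p := by exact_mod_cast (Nat.prime_of_mem_primeFactors hp).one_lt.le
    split_ifs with h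
    · linarith [Real.one_le_rpow hp1 hδ.le]
    · have h2 : (2 : ℝ) ^ δ⁻¹ ≤ p := hB.le.trans (by exact_mod_cast not_lt.1 h)
      have h3 := Real.rpow_le_rpow (by positivity) h2 hδ.le
      rwa [← Real.rpow_mul (by norm_num), inv_mul_cancel₀ hδ.ne', Real.rpow_one, ← one_mul (_ ^ δ)]
        at h3
  calc (2 : ℝ) ^ #n.primeFactors = ∏ p ∈ n.primeFactors, (2 : ℝ) := by simp
    _ ≤ ∏ p ∈ n.primeFactors, (if p < B then 2 else 1) * (p : ℝ) ^ δ :=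
        Finset.prod_le_prod (fun _ _ => by norm_num) h1
    _ = (∏ p ∈ n.primeFactors, (if p < B then (2 : ℝ) else 1)) *
        ((∏ p ∈ n.primeFactors, p : ℕ) : ℝ) ^ δ := by
        rw [Finset.prod_mul_distrib, Real.finsetProd_rpow _ _ fun p _ => p.cast_nonneg]
        push_cast
        rfl
    _ ≤ 2 ^ B * (n : ℝ) ^ δ := by
        refine mul_le_mul ?_ (Real.rpow_le_rpow (Nat.cast_nonneg _) (Nat.cast_le.2
          (Nat.le_of_dvd hn (Nat.prod_primeFactors_dvd n))) hδ.le) (by positivity) (by positivity)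
        rw [← Finset.prod_filter, Finset.prod_const]
        refine pow_le_pow_right₀ (by norm_num) ?_
        refine (card_le_card (t := Finset.range B) fun p hp =>
          Finset.mem_range.2 (mem_filter.1 hp).2).trans (by simp)

lemma LambdaR_eq_sieveSum {R : ℝ} (hR : 0 ≤ R) {K : ℕ} (hK : R ≤ K) {W : ℕ}
    (r : ℕ) : LambdaR R (W * r + 1) =
      sieveSum R (sievedPrimes W (primesAvoiding K W.primeFactors) r) := by
  set Z := sievedPrimes W (primesAvoiding K W.primeFactors) r with hZdef
  have hZ : ∀ p, p ∈ Z ↔ (p ≤ K ∧ p.Prime ∧ p ∉ W.primeFactors) ∧ p ∣ W * r + 1 := by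
    intro p
    rw [hZdef, sievedPrimes, mem_filter, mem_primesAvoiding]
    exact and_congr_right fun _ => by exact_mod_cast Iff.rfl
  have h := sum_powerset_primes Z (fun p hp => ((hZ p).1 hp).1.2.1)
    ((W * r + 1).divisors.filter (fun d : ℕ => (d : ℝ) ≤ R))
    (fun d => ((ArithmeticFunction.moebius d : ℤ) : ℝ) * Real.posLog (R / d)) ?_ ?_
  · rw [LambdaR, sieveSum]
    calc _ = ∑ d ∈ (W * r + 1).divisors.filter (fun d : ℕ => (d : ℝ) ≤ R),
          ((ArithmeticFunction.moebius d : ℤ) : ℝ) * Real.posLog (R / d) := by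
          refine Finset.sum_congr rfl fun d hd => ?_
          rw [mem_filter, Nat.mem_divisors] at hd
          have hd0 : (0 : ℝ) < d := by
            exact_mod_cast Nat.pos_of_ne_zero (ne_zero_of_dvd_ne_zero hd.1.2 hd.1.1)
          have h1 : 1 ≤ R / d := (one_le_div hd0).2 hd.2
          rw [Real.posLog_eq_log (by rwa [abs_of_nonneg (zero_le_one.trans h1)])]
      _ = _ := by
          rw [← h]
          refine Finset.sum_congr rfl fun D hD => ?_
          rw [moebius_prod_primes fun p hp => ((hZ p).1 (mem_powerset.1 hD hp)).1.2.1, sieveWeight]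
          push_cast
          rfl
  · intro d hd hsub hne
    have hd0 : (0 : ℝ) < d := by exact_mod_cast Nat.pos_of_ne_zero hd.ne_zero
    rw [mem_filter, Nat.mem_divisors]
    refine ⟨⟨?_, by omega⟩, ?_⟩
    · rw [← Nat.prod_primeFactors_of_squarefree hd]
      exact Finset.prod_primes_dvd _ (fun p hp => (Nat.prime_of_mem_primeFactors hp).prime)
        fun p hp => ((hZ p).1 (hsub hp)).2
    · by_contra! hlt
      exact hne (by
        rw [posLog_eq_zero_of_lt (by positivity) ((div_le_one hd0).2 hlt.le), mul_zero])
  · intro d hd hne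
    rw [mem_filter, Nat.mem_divisors] at hd
    have hsq := moebius_ne_zero_squarefree (d := d) (by
      intro h0
      exact hne (by rw [h0]; simp))
    refine ⟨hsq, fun p hp => (hZ p).2 ?_⟩
    have hpp := Nat.prime_of_mem_primeFactors hp
    have hpd := Nat.dvd_of_mem_primeFactors hp
    have hpn := hpd.trans hd.1.1
    refine ⟨⟨?_, hpp, fun hpW => ?_⟩, hpn⟩
    · have h1 : (p : ℝ) ≤ d := by
        exact_mod_cast Nat.le_of_dvd (Nat.pos_of_ne_zero hsq.ne_zero) hpd
      exact_mod_cast h1.trans (hd.2.trans hK)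
    · have h1 : p ∣ W * r := (Nat.dvd_of_mem_primeFactors hpW).mul_right r
      exact hpp.one_lt.ne' (Nat.dvd_one.1 ((Nat.dvd_add_right h1).1 hpn))

lemma abs_sieveSum_le {R : ℝ} (hR : 1 ≤ R) {Z : Finset ℕ} (hZ : ∀ p ∈ Z, p.Prime) :
    |sieveSum R Z| ≤ 2 ^ #Z * Real.log R := by
  refine (Finset.abs_sum_le_sum_abs _ _).trans ?_
  have h : ∀ D ∈ Z.powerset, |sieveWeight R D| ≤ Real.log R := by
    intro D hD
    rw [sieveWeight, abs_mul, abs_pow, abs_neg, abs_one, one_pow, one_mul,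
      abs_of_nonneg Real.posLog_nonneg]
    have h1 := one_le_prod_cast fun p hp => hZ p (mem_powerset.1 hD hp)
    have h2 : R / ∏ p ∈ D, (p : ℝ) ≤ R := div_le_self (by linarith) h1
    exact max_le (Real.log_nonneg hR) (Real.log_le_log (by positivity) h2)
  refine (Finset.sum_le_card_nsmul _ _ _ h).trans ?_
  rw [card_powerset, nsmul_eq_mul]
  push_cast
  rfl

lemma abs_LambdaR_le {R : ℝ} (hR : 1 ≤ R) (W r : ℕ) :
    |LambdaR R (W * r + 1)| ≤ 2 ^ #(W * r + 1).primeFactors * Real.log R := by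
  rw [LambdaR_eq_sieveSum (zero_le_one.trans hR) (Nat.le_ceil R)]
  have hP : ∀ p ∈ sievedPrimes W (primesAvoiding ⌈R⌉₊ W.primeFactors) r, p.Prime ∧
      p ∣ W * r + 1 := by
    intro p hp
    rw [sievedPrimes, mem_filter, mem_primesAvoiding] at hp
    exact ⟨hp.1.2.1, by exact_mod_cast hp.2⟩
  refine (abs_sieveSum_le hR fun p hp => (hP p hp).1).trans ?_
  refine mul_le_mul_of_nonneg_right (pow_le_pow_right₀ (by norm_num) (card_le_card fun p hp => ?_))
    (Real.log_nonneg hR)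
  exact Nat.mem_primeFactors.2 ⟨(hP p hp).1, (hP p hp).2, by omega⟩

lemma totient_div_le_one (W : ℕ) : (Nat.totient W : ℝ) / W ≤ 1 :=
  div_le_one_of_le₀ (by exact_mod_cast Nat.totient_le W) W.cast_nonneg

lemma sum_range_cast_zmod {m : ℕ} [NeZero m] (g : ZMod m → ℝ) :
    ∑ x ∈ Finset.range m, g (x : ZMod m) = ∑ x : ZMod m, g x := by
  refine Finset.sum_nbij' (fun x => (x : ZMod m)) ZMod.val (by simp) (fun x _ => ?_)
    (fun x hx => ?_) (fun x _ => ?_) (by simp)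
  · exact Finset.mem_range.2 (ZMod.val_lt x)
  · exact ZMod.val_cast_of_lt (Finset.mem_range.1 hx)
  · exact ZMod.natCast_zmod_val x

lemma sum_zmod_val_add {m : ℕ} [NeZero m] (c : ZMod m) (N : ℕ) (f : ℤ → ℝ) :
    ∑ x : ZMod m, f ((N + (x + c).val : ℕ) : ℤ) = ∑ n ∈ Ico (N : ℤ) (N + m), f n := by
  rw [Fintype.sum_equiv (Equiv.addRight c) (fun x : ZMod m => f ((N + (x + c).val : ℕ) : ℤ))
    (fun y => f ((N + y.val : ℕ) : ℤ)) fun x => rfl]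
  refine Finset.sum_nbij' (fun x => ((N + x.val : ℕ) : ℤ)) (fun n => ((n - N).toNat : ZMod m))
    (fun x _ => ?_) (by simp) (fun x _ => by
      simpa [-ZMod.natCast_val] using ZMod.natCast_zmod_val x) (fun n hn => ?_) (by simp)
  · have := ZMod.val_lt x
    rw [mem_Ico]
    push_cast
    omega
  · rw [mem_Ico] at hn
    rw [ZMod.val_cast_of_lt (by omega)]
    push_cast
    omega

/-- The part of `ν` carried by the window. -/
def windowNu (k N W : ℕ) {m : ℕ} (n : ZMod m) : ℝ :=
  if inWindow k N n then nuGT k N W n else 0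

lemma one_lt_Rpar {k m : ℕ} (hk : 0 < k) (hm : 1 < m) : 1 < Rpar k m :=
  Real.one_lt_rpow (by exact_mod_cast hm) (by positivity)

lemma nuGT_nonneg {k m : ℕ} (hk : 0 < k) (hm : 1 < m) (N W : ℕ) (n : ZMod m) :
    0 ≤ nuGT k N W n := by
  have := Real.log_nonneg (one_lt_Rpar hk hm).le
  rw [nuGT]
  split_ifs
  · positivity
  · exact zero_le_one

lemma windowNu_nonneg {k m : ℕ} (hk : 0 < k) (hm : 1 < m) (N W : ℕ) (n : ZMod m) :
    0 ≤ windowNu k N W n := by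
  rw [windowNu]
  split_ifs
  · exact nuGT_nonneg hk hm N W n
  · exact le_rfl

lemma nuGT_le_one_add {k m : ℕ} (N W : ℕ) (n : ZMod m) :
    nuGT k N W n ≤ 1 + windowNu k N W n := by
  by_cases h : inWindow k N n
  · rw [windowNu, if_pos h]
    linarith
  · rw [windowNu, if_neg h, nuGT, if_neg h, add_zero]

lemma epsk_le (k : ℕ) (hk : 3 < k) : epsk k ≤ 1 / 16 := by
  rw [epsk]
  have h1 : (2 : ℝ) ^ 4 ≤ 2 ^ k := pow_le_pow_right₀ (by norm_num) hk
  have h2 : (1 : ℝ) ≤ (Nat.factorial (k + 4) : ℝ) := by exact_mod_cast Nat.factorial_pos _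
  exact one_div_le_one_div_of_le (by norm_num) (by nlinarith)

lemma reprN_eq_of_inWindow {k N m : ℕ} (hk : 3 < k) [NeZero m] {y z : ZMod m}
    (hy : inWindow k N y) (hz : inWindow k N z) :
    (reprN N y : ℤ) = reprN N z + (y - z).valMinAbs := by
  have he := epsk_le k hk
  have hm : (0 : ℝ) < m := by exact_mod_cast NeZero.pos m
  have h1 : (y - z).valMinAbs = ((y - N).val : ℤ) - (z - N).val := by
    refine (ZMod.valMinAbs_spec _ _).2 ⟨by push_cast; simp, ?_⟩
    obtain ⟨hy1, hy2⟩ := hy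
    obtain ⟨hz1, hz2⟩ := hz
    have hem : epsk k * m ≤ 1 / 16 * m := mul_le_mul_of_nonneg_right he hm.le
    have h2 : -(m : ℝ) < (((y - N).val : ℝ) - (z - N).val) * 2 := by linarith
    have h3 : (((y - N).val : ℝ) - (z - N).val) * 2 ≤ (m : ℝ) := by linarith
    exact ⟨by exact_mod_cast h2, by exact_mod_cast h3⟩
  rw [h1, reprN, reprN]
  push_cast
  ring

lemma valMinAbs_sub_injective {ι : Type*} {m : ℕ} [NeZero m] {h : ι → ZMod m}
    (hh : Function.Injective h) (c : ZMod m) :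
    Function.Injective fun i => (h i - c).valMinAbs := by
  intro i j hij
  have := congrArg (Int.cast : ℤ → ZMod m) hij
  simp only [ZMod.coe_valMinAbs] at this
  exact hh (sub_left_injective this)

lemma natAbs_valMinAbs_sub {m : ℕ} [NeZero m] {x y : ZMod m} (hxy : x ≠ y) :
    (x.valMinAbs - y.valMinAbs).natAbs = (x - y).val ∨
      (x.valMinAbs - y.valMinAbs).natAbs = m - (x - y).val := by
  set d := x.valMinAbs - y.valMinAbs with hd
  have hcast : ((d : ℤ) : ZMod m) = x - y := by
    rw [hd]; push_cast [ZMod.coe_valMinAbs]; rfl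
  have hx := ZMod.valMinAbs_mem_Ioc x
  have hy := ZMod.valMinAbs_mem_Ioc y
  rw [Set.mem_Ioc] at hx hy
  have hne : d ≠ 0 := fun h0 => by
    rw [h0, Int.cast_zero] at hcast
    exact hxy (sub_eq_zero.1 hcast.symm)
  have hm := NeZero.pos m
  have hval : ((x - y).val : ℤ) = d % m := by rw [← hcast, ZMod.val_intCast]
  have hlt : d < m := by omega
  have hgt : -(m : ℤ) < d := by omega
  rcases lt_or_gt_of_ne hne with h | h
  · right
    rw [← Int.add_emod_right, Int.emod_eq_of_lt (by omega) (by omega)] at hval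
    omega
  · left
    rw [Int.emod_eq_of_lt h.le hlt] at hval
    omega

/-- A symmetric weight on nonzero residues, controlling the primes dividing the two
representatives of smallest absolute value. -/
def pairWeight (c : ℝ) {m : ℕ} (n : ZMod m) : ℝ :=
  primeFactorProd c n.val + primeFactorProd c (m - n.val)

lemma one_le_pairWeight {c : ℝ} (hc : 0 ≤ c) {m : ℕ} (n : ZMod m) : 1 ≤ pairWeight c n := by
  have h1 := one_le_primeFactorProd hc n.val
  have h2 := one_le_primeFactorProd hc (m - n.val)
  rw [pairWeight]
  linarith

lemma pairWeight_neg (c : ℝ) {m : ℕ} [NeZero m] (n : ZMod m) (hn : n ≠ 0) :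
    pairWeight c (-n) = pairWeight c n := by
  have : NeZero n := ⟨hn⟩
  have h := ZMod.val_lt n
  rw [pairWeight, pairWeight, ZMod.val_neg_of_ne_zero, add_comm,
    show m - (m - n.val) = n.val by omega]

lemma pairWeight_mono {c c' : ℝ} (hc : 0 ≤ c) (hcc : c ≤ c') {m : ℕ} (n : ZMod m) :
    pairWeight c n ≤ pairWeight c' n :=
  add_le_add (primeFactorProd_mono hc hcc _) (primeFactorProd_mono hc hcc _)

lemma primeFactorProd_natAbs_le_pairWeight {c : ℝ} (hc : 0 ≤ c) {m : ℕ} [NeZero m] {x y : ZMod m}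
    (hxy : x ≠ y) :
    primeFactorProd c (x.valMinAbs - y.valMinAbs).natAbs ≤ pairWeight c (x - y) := by
  have h1 := primeFactorProd_pos hc (x - y).val
  have h2 := primeFactorProd_pos hc (m - (x - y).val)
  rw [pairWeight]
  rcases natAbs_valMinAbs_sub hxy with h | h <;> rw [h] <;> linarith

lemma prod_windowNu_le {ι : Type*} [Fintype ι] {k N W m : ℕ} (hk : 3 < k) (hm : 1 < m)
    {K : ℕ} (hK : Rpar k m ≤ K) (h : ι → ZMod m) (i₀ : ι) (x : ZMod m) :
    ∏ i, windowNu k N W (x + h i) ≤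
      ((Nat.totient W : ℝ) / W / Real.log (Rpar k m)) ^ Fintype.card ι *
      ∏ i, sieveSum (Rpar k m) (sievedPrimes W (primesAvoiding K W.primeFactors)
        ((N + (x + (h i₀ - N)).val : ℕ) + (h i - h i₀).valMinAbs)) ^ 2 := by
  have hR := one_lt_Rpar (k := k) (by omega) hm
  have hlog := Real.log_pos hR
  have : NeZero m := ⟨by omega⟩
  by_cases hx : ∀ i, inWindow k N (x + h i)
  · rw [← Finset.card_univ, ← Finset.prod_const, ← Finset.prod_mul_distrib]
    refine Finset.prod_le_prod (fun i _ => windowNu_nonneg (by omega) hm _ _ _)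
      fun i _ => le_of_eq ?_
    rw [windowNu, if_pos (hx i), nuGT, if_pos (hx i),
      LambdaR_eq_sieveSum (zero_le_one.trans hR.le) hK, reprN_eq_of_inWindow hk (hx i) (hx i₀),
      add_sub_add_left_eq_sub, reprN, add_sub_assoc]
    ring
  · push Not at hx
    obtain ⟨i, hi⟩ := hx
    rw [Finset.prod_eq_zero (Finset.mem_univ i) (by rw [windowNu, if_neg hi])]
    positivity

lemma sum_prod_windowNu_le {ι : Type*} [Fintype ι] [Nonempty ι] {k N W m : ℕ} [NeZero m]
    (hk : 3 < k) (hm : 1 < m) (hW : 0 < W) (hL : 1 ≤ Real.log (Rpar k m))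
    (hWL : W * (1 + Real.log W) ≤ Real.log (Rpar k m))
    (hRm : Rpar k m ^ (4 * Fintype.card ι) ≤ m) {h : ι → ZMod m} (hh : Function.Injective h) :
    ∑ x : ZMod m, ∏ i, windowNu k N W (x + h i) ≤
      m * (225 ^ Fintype.card ι * (Real.exp (16 ^ Fintype.card ι * (Fintype.card ι : ℝ) ^ 2) *
        ∏ x ∈ (univ : Finset ι).offDiag,
          pairWeight (16 ^ Fintype.card ι * (2 * Fintype.card ι)) (h x.1 - h x.2)) + 1) := by
  obtain ⟨i₀⟩ := ‹Nonempty ι›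
  have hR := one_lt_Rpar (k := k) (by omega) hm
  set R := Rpar k m with hRdef
  set K := ⌈R⌉₊
  set c := (Nat.totient W : ℝ) / W / Real.log R with hc
  set n := Fintype.card ι with hn
  have hW0 : (0 : ℝ) < W := by exact_mod_cast hW
  have hphi : (0 : ℝ) < Nat.totient W := by exact_mod_cast Nat.totient_pos.2 hW
  have hL0 : 0 < Real.log R := by linarith
  have hc0 : 0 ≤ c := by positivity
  have hc1 : c ≤ 1 := div_le_one_of_le₀ ((totient_div_le_one W).trans hL) hL0.le
  have hcV : c * (225 * ((W : ℝ) / Nat.totient W * Real.log R)) = 225 := by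
    rw [hc]; field_simp
  set s : ι → ℤ := fun i => (h i - h i₀).valMinAbs with hs
  have hcore := sum_sieveSum_sq_le_of_injective (zero_le_one.trans hR.le) hL le_rfl
    (Nat.le_ceil R) hW hWL (valMinAbs_sub_injective hh (h i₀)) N m
  have h1 : ∑ x : ZMod m, ∏ i, windowNu k N W (x + h i) ≤
      c ^ n * ∑ u ∈ Ico (N : ℤ) (N + m), ∏ i, sieveSum R
        (sievedPrimes W (primesAvoiding K W.primeFactors) (u + s i)) ^ 2 := by
    rw [← sum_zmod_val_add (h i₀ - (N : ZMod m)), Finset.mul_sum]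
    exact Finset.sum_le_sum fun x _ => prod_windowNu_le hk hm (Nat.le_ceil R) h i₀ x
  refine h1.trans ((mul_le_mul_of_nonneg_left hcore (by positivity)).trans ?_)
  rw [mul_add, mul_add]
  refine add_le_add ?_ ?_
  · rw [mul_left_comm, ← mul_assoc (c ^ n), ← mul_pow, hcV]
    gcongr with x hx
    · exact fun x _ => (primeFactorProd_pos (by positivity) _).le
    · refine (primeFactorProd_natAbs_le_pairWeight (by positivity) fun h0 => ?_).trans ?_
      · exact (mem_offDiag.1 hx).2.2 (hh (sub_left_injective h0))
      · rw [sub_sub_sub_cancel_right]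
  · rw [mul_one]
    exact (mul_le_of_le_one_left (by positivity) (pow_le_one₀ hc0 hc1)).trans hRm

lemma prod_le_sum_pow {α : Type*} {s : Finset α} (hs : s.Nonempty) {f : α → ℝ}
    (hf : ∀ a ∈ s, 0 ≤ f a) : ∏ a ∈ s, f a ≤ ∑ a ∈ s, f a ^ #s := by
  obtain ⟨b, hb, hmax⟩ := s.exists_max_image f hs
  calc ∏ a ∈ s, f a ≤ ∏ _a ∈ s, f b := Finset.prod_le_prod hf hmax
    _ = f b ^ #s := Finset.prod_const _
    _ ≤ ∑ a ∈ s, f a ^ #s :=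
      Finset.single_le_sum (f := fun a => f a ^ #s) (fun a ha => pow_nonneg (hf a ha) _) hb

lemma sum_offDiag_eq {l : ℕ} (f : Fin l → Fin l → ℝ) (hf : ∀ i j, i ≠ j → f i j = f j i) :
    ∑ x ∈ (univ : Finset (Fin l)).offDiag, f x.1 x.2 =
      2 * ∑ i, ∑ j, if i < j then f i j else 0 := by
  have h1 : ∑ x ∈ (univ : Finset (Fin l)).offDiag, f x.1 x.2 =
      ∑ i, ∑ j, ((if i < j then f i j else 0) + if j < i then f j i else 0) := by
    rw [show (univ : Finset (Fin l)).offDiag =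
        {x ∈ (univ : Finset (Fin l)) ×ˢ (univ : Finset (Fin l)) | x.1 ≠ x.2} by
      ext x; simp [mem_offDiag], Finset.sum_filter, Finset.sum_product]
    refine Finset.sum_congr rfl fun i _ => Finset.sum_congr rfl fun j _ => ?_
    rcases lt_trichotomy i j with h | h | h
    · simp [h, h.ne, h.not_gt]
    · simp [h]
    · simp [h, h.ne', h.not_gt, hf i j h.ne']
  rw [h1, two_mul]
  simp_rw [Finset.sum_add_distrib]
  congr 1
  exact Finset.sum_comm

lemma sum_prod_nuGT_le {k N W m l : ℕ} [NeZero m] (hk : 3 < k)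
    (hm : 1 < m) (hW : 0 < W) (hL : 1 ≤ Real.log (Rpar k m))
    (hWL : W * (1 + Real.log W) ≤ Real.log (Rpar k m))
    (hRm : Rpar k m ^ (4 * l) ≤ m) {h : Fin l → ZMod m} (hh : Function.Injective h) :
    ∑ x : ZMod m, ∏ i, nuGT k N W (x + h i) ≤
      m * (2 ^ (l + 1) * (225 ^ l * Real.exp (16 ^ l * (l : ℝ) ^ 2)) *
        ∏ x ∈ (univ : Finset (Fin l)).offDiag,
          pairWeight (16 ^ l * (2 * l)) (h x.1 - h x.2)) := by
  set D : ℝ := 225 ^ l * Real.exp (16 ^ l * (l : ℝ) ^ 2) with hD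
  set Q : ℝ := ∏ x ∈ (univ : Finset (Fin l)).offDiag,
    pairWeight (16 ^ l * (2 * l)) (h x.1 - h x.2) with hQ
  have hD1 : 1 ≤ D := one_le_mul_of_one_le_of_one_le (one_le_pow₀ (by norm_num))
    (Real.one_le_exp (by positivity))
  have hQ1 : 1 ≤ Q := Finset.one_le_prod fun x _ => one_le_pairWeight (by positivity) _
  have hDQ : 1 ≤ D * Q := one_le_mul_of_one_le_of_one_le hD1 hQ1
  have hsub : ∀ A : Finset (Fin l),
      ∑ x : ZMod m, ∏ i ∈ A, windowNu k N W (x + h i) ≤ m * (2 * (D * Q)) := by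
    intro A
    rcases A.eq_empty_or_nonempty with rfl | hA
    · simp only [Finset.prod_empty, Finset.sum_const, Finset.card_univ, ZMod.card, nsmul_eq_mul]
      gcongr
      linarith
    · have : Nonempty A := hA.to_subtype
      have hcard : Fintype.card A ≤ l := by
        rw [Fintype.card_coe]
        exact (card_le_univ A).trans (by simp)
      have hR := one_lt_Rpar (k := k) (by omega) hm
      have h1 := sum_prod_windowNu_le (ι := A) (N := N) hk hm hW hL hWL
        ((pow_le_pow_right₀ hR.le (by omega)).trans hRm)
        (hh.comp Subtype.val_injective)
      simp only [Function.comp_apply] at h1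
      have hc : (Fintype.card A : ℝ) ≤ l := by exact_mod_cast hcard
      have h2 : (∏ x ∈ (univ : Finset A).offDiag,
          pairWeight (16 ^ Fintype.card A * (2 * Fintype.card A)) (h x.1 - h x.2)) ≤ Q := by
        refine (Finset.prod_le_prod (fun x _ => zero_le_one.trans
          (one_le_pairWeight (by positivity) _)) fun x _ => pairWeight_mono (by positivity)
          (c' := 16 ^ l * (2 * l)) (by gcongr; norm_num) _).trans ?_
        have h3 := Finset.prod_map (univ : Finset A).offDiag
          ((Function.Embedding.subtype (· ∈ A)).prodMap (Function.Embedding.subtype (· ∈ A)))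
          (fun x : Fin l × Fin l => pairWeight (16 ^ l * (2 * l)) (h x.1 - h x.2))
        refine (le_of_eq h3.symm).trans ?_
        refine Finset.prod_le_prod_of_subset_of_one_le ?_ (fun x _ => zero_le_one.trans
          (one_le_pairWeight (by positivity) _)) fun x _ _ => one_le_pairWeight (by positivity) _
        intro x hx
        obtain ⟨y, hy, rfl⟩ := Finset.mem_map.1 hx
        rw [mem_offDiag] at hy ⊢
        exact ⟨Finset.mem_univ _, Finset.mem_univ _, fun he => hy.2.2 (Subtype.ext he)⟩
      have h3 : (225 : ℝ) ^ Fintype.card A *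
          (Real.exp (16 ^ Fintype.card A * (Fintype.card A : ℝ) ^ 2) *
          ∏ x ∈ (univ : Finset A).offDiag,
            pairWeight (16 ^ Fintype.card A * (2 * Fintype.card A)) (h x.1 - h x.2)) ≤ D * Q := by
        rw [← mul_assoc]
        refine mul_le_mul ?_ h2 (Finset.prod_nonneg fun x _ => zero_le_one.trans
          (one_le_pairWeight (by positivity) _)) (by positivity)
        rw [hD]
        gcongr <;> norm_num
      calc _ = ∑ x : ZMod m, ∏ i : A, windowNu k N W (x + h i) :=
            Finset.sum_congr rfl fun x _ =>
              (Finset.prod_coe_sort A fun i => windowNu k N W (x + h i)).symm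
        _ ≤ _ := h1
        _ ≤ _ := by
          gcongr
          linarith
  calc ∑ x : ZMod m, ∏ i, nuGT k N W (x + h i)
      ≤ ∑ x : ZMod m, ∏ i, (1 + windowNu k N W (x + h i)) :=
        Finset.sum_le_sum fun x _ => Finset.prod_le_prod
          (fun i _ => nuGT_nonneg (by omega) hm _ _ _) fun i _ => nuGT_le_one_add _ _ _
    _ = ∑ A ∈ (univ : Finset (Fin l)).powerset,
          ∑ x : ZMod m, ∏ i ∈ A, windowNu k N W (x + h i) := by
        rw [Finset.sum_comm]
        exact Finset.sum_congr rfl fun x _ => Finset.prod_one_add _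
    _ ≤ ∑ A ∈ (univ : Finset (Fin l)).powerset, m * (2 * (D * Q)) :=
        Finset.sum_le_sum fun A _ => hsub A
    _ = m * (2 ^ (l + 1) * D * Q) := by
        rw [Finset.sum_const, card_powerset, Finset.card_univ, Fintype.card_fin, nsmul_eq_mul]
        push_cast
        ring

lemma avgZ_prod_nuGT_le {k N W m l : ℕ} [NeZero m] (hk : 3 < k)
    (hm : 1 < m) (hW : 0 < W) (hL : 1 ≤ Real.log (Rpar k m))
    (hWL : W * (1 + Real.log W) ≤ Real.log (Rpar k m)) (hl : 1 < l)
    (hRm : Rpar k m ^ (4 * l) ≤ m) {h : Fin l → ZMod m} (hh : Function.Injective h) :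
    avgZ m (fun x => ∏ i, nuGT k N W (x + h i)) ≤
      ∑ i, ∑ j, if i < j then 2 ^ (l + 2) * (225 ^ l * Real.exp (16 ^ l * (l : ℝ) ^ 2)) *
        pairWeight (16 ^ l * (2 * l)) (h i - h j) ^ #(univ : Finset (Fin l)).offDiag else 0 := by
  have hm0 : (0 : ℝ) < m := by exact_mod_cast NeZero.pos m
  set e := #(univ : Finset (Fin l)).offDiag
  set D : ℝ := 225 ^ l * Real.exp (16 ^ l * (l : ℝ) ^ 2) with hD
  rw [avgZ, sum_range_cast_zmod fun x => ∏ i, nuGT k N W (x + h i), div_le_iff₀ hm0, mul_comm]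
  refine (sum_prod_nuGT_le hk hm hW hL hWL hRm hh).trans ?_
  refine mul_le_mul_of_nonneg_left ?_ hm0.le
  have hne : (univ : Finset (Fin l)).offDiag.Nonempty :=
    ⟨(⟨0, by omega⟩, ⟨1, hl⟩), by simp [mem_offDiag]⟩
  refine (mul_le_mul_of_nonneg_left (prod_le_sum_pow hne fun x _ => zero_le_one.trans
    (one_le_pairWeight (by positivity) _)) (by positivity)).trans ?_
  rw [sum_offDiag_eq (fun i j => pairWeight (16 ^ l * (2 * l)) (h i - h j) ^ e) fun i j hij => by
    rw [← pairWeight_neg _ _ (sub_ne_zero.2 fun h0 => hij (hh h0)), neg_sub],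
    ← mul_assoc, Finset.mul_sum]
  refine Finset.sum_le_sum fun i _ => ?_
  rw [Finset.mul_sum]
  refine Finset.sum_le_sum fun j _ => ?_
  split_ifs
  · exact le_of_eq (by ring)
  · simp

lemma sum_pairWeight_pow_le {c : ℝ} (hc : 0 ≤ c) (E m : ℕ) :
    ∑ x ∈ Ioo 0 m, pairWeight c (x : ZMod m) ^ E ≤
      2 ^ (E + 1) * Real.exp ((1 + c) ^ E) * m := by
  have h1 : ∀ x ∈ Ioo 0 m, pairWeight c (x : ZMod m) ^ E ≤
      2 ^ E * (primeFactorProd ((1 + c) ^ E) x + primeFactorProd ((1 + c) ^ E) (m - x)) := by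
    intro x hx
    rw [mem_Ioo] at hx
    have hx1 := primeFactorProd_pos hc x
    have hx2 := primeFactorProd_pos hc (m - x)
    rw [pairWeight, ZMod.val_cast_of_lt hx.2]
    refine (add_pow_le hx1.le hx2.le E).trans ?_
    gcongr
    · norm_num
    · omega
    · exact primeFactorProd_pow_le hc _ _
    · exact primeFactorProd_pow_le hc _ _
  have h2 : ∑ x ∈ Ioo 0 m, primeFactorProd ((1 + c) ^ E) x ≤ Real.exp ((1 + c) ^ E) * m := by
    refine (Finset.sum_le_sum_of_subset_of_nonneg ?_ fun x _ _ =>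
      (primeFactorProd_pos (by positivity) x).le).trans
      (sum_primeFactorProd_le (by positivity) m)
    exact Ioo_subset_Ioc_self
  have h3 : ∑ x ∈ Ioo 0 m, primeFactorProd ((1 + c) ^ E) (m - x) =
      ∑ x ∈ Ioo 0 m, primeFactorProd ((1 + c) ^ E) x := by
    refine Finset.sum_nbij' (fun x => m - x) (fun x => m - x) ?_ ?_ ?_ ?_ ?_ <;>
      intro x hx <;> simp only [mem_Ioo] at hx ⊢ <;> omega
  refine (Finset.sum_le_sum h1).trans ?_
  rw [← Finset.mul_sum, Finset.sum_add_distrib, h3, pow_succ]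
  nlinarith [pow_pos (two_pos (α := ℝ)) E]

lemma nuGT_le_max {k m : ℕ} (hk : 0 < k) (hm : 1 < m) (N W : ℕ) (n : ZMod m) :
    nuGT k N W n ≤
      max 1 ((2 ^ #(W * reprN N n + 1).primeFactors) ^ 2 * Real.log (Rpar k m)) := by
  have hR := one_lt_Rpar hk hm
  have hlog := Real.log_pos hR
  rw [nuGT]
  split_ifs
  · refine le_max_of_le_right ?_
    rw [div_le_iff₀ hlog]
    have h1 := abs_LambdaR_le hR.le W (reprN N n)
    have h2 := sq_le_sq.2 (h1.trans (le_abs_self _))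
    refine (mul_le_of_le_one_left (sq_nonneg _) (totient_div_le_one W)).trans (h2.trans ?_)
    exact le_of_eq (by ring)
  · exact le_max_left _ _

lemma log_Rpar {k m : ℕ} (hm : 1 < m) :
    Real.log (Rpar k m) = 1 / (k * 2 ^ (k + 4)) * Real.log m :=
  Real.log_rpow (by exact_mod_cast (zero_lt_one.trans hm)) _

lemma log_Rpar_le {k m : ℕ} (hk : 0 < k) (hm : 1 < m) : Real.log (Rpar k m) ≤ Real.log m := by
  have hm' : (1 : ℝ) ≤ m := by exact_mod_cast hm.le
  have hk' : (1 : ℝ) ≤ k := by exact_mod_cast hk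
  rw [log_Rpar hm]
  refine mul_le_of_le_one_left (Real.log_nonneg hm') (div_le_one_of_le₀ ?_ (by positivity))
  exact one_le_mul_of_one_le_of_one_le hk' (one_le_pow₀ (by norm_num))

lemma Rpar_pow_le {k m l : ℕ} (hk : 0 < k) (hm : 1 < m) (hl : l ≤ 2 ^ (k - 1)) :
    Rpar k m ^ (4 * l) ≤ m := by
  have hm' : (1 : ℝ) ≤ m := by exact_mod_cast hm.le
  have hk' : (1 : ℝ) ≤ k := by exact_mod_cast hk
  rw [Rpar, ← Real.rpow_natCast, ← Real.rpow_mul (by linarith)]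
  refine (Real.rpow_le_rpow_of_exponent_le hm' ?_).trans_eq (Real.rpow_one _)
  rw [one_div_mul_eq_div]
  refine div_le_one_of_le₀ ?_ (by positivity)
  have h1 : 4 * l ≤ k * 2 ^ (k + 4) := by
    calc 4 * l ≤ 4 * 2 ^ (k - 1) := by omega
      _ ≤ 4 * 2 ^ k := by gcongr <;> omega
      _ ≤ 1 * 2 ^ (k + 4) := by rw [pow_add]; omega
      _ ≤ k * 2 ^ (k + 4) := by gcongr; exact hk
  exact_mod_cast h1

lemma nuGT_le_rpow {k : ℕ} (hk : 0 < k) {ε δ : ℝ} (hε : 0 < ε) (hδ : 0 < δ) :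
    ∃ C : ℝ, 0 < C ∧ ∀ N W m : ℕ, 1 < m → m ≤ N → (N : ℝ) ^ ε < m → W ≤ N → ∀ n : ZMod m,
      nuGT k N W n ≤ C * (m : ℝ) ^ δ := by
  obtain ⟨C, hC, h⟩ := two_pow_card_primeFactors_le (δ := δ * ε / 8) (by positivity)
  refine ⟨1 + (C * 3 ^ (δ * ε / 8)) ^ 2 * (2 / δ), by positivity,
    fun N W m hm hmN hNm hWN n => ?_⟩
  have hm' : (1 : ℝ) ≤ m := by exact_mod_cast hm.le
  have hN1 : (1 : ℝ) ≤ N := hm'.trans (by exact_mod_cast hmN)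
  have : NeZero m := ⟨by omega⟩
  have hr : reprN N n ≤ 2 * N := by
    have := ZMod.val_lt (n - (N : ZMod m))
    rw [reprN]; omega
  have hn : ((W * reprN N n + 1 : ℕ) : ℝ) ≤ 3 * (N : ℝ) ^ (2 : ℝ) := by
    have h1 : W * reprN N n ≤ N * (2 * N) := Nat.mul_le_mul hWN hr
    have h2 : ((W * reprN N n : ℕ) : ℝ) ≤ N * (2 * N) := by exact_mod_cast h1
    rw [Real.rpow_two]
    push_cast at h2 ⊢
    nlinarith
  have hpow : (2 : ℝ) ^ #(W * reprN N n + 1).primeFactors ≤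
      C * 3 ^ (δ * ε / 8) * (m : ℝ) ^ (δ / 4) := by
    refine (h _ (by omega)).trans ?_
    rw [mul_assoc]
    refine mul_le_mul_of_nonneg_left ?_ hC.le
    refine (Real.rpow_le_rpow (Nat.cast_nonneg _) hn (by positivity)).trans ?_
    rw [Real.mul_rpow (by norm_num) (by positivity), ← Real.rpow_mul (by positivity)]
    refine mul_le_mul_of_nonneg_left ?_ (by positivity)
    have h3 := Real.rpow_le_rpow (by positivity) hNm.le (show 0 ≤ δ / 4 by positivity)
    rw [← Real.rpow_mul (by positivity)] at h3
    refine le_trans (le_of_eq ?_) h3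
    congr 1
    ring
  have hlog : Real.log (Rpar k m) ≤ 2 / δ * (m : ℝ) ^ (δ / 2) := by
    refine (log_Rpar_le hk hm).trans
      ((Real.log_le_rpow_div (by positivity) (half_pos hδ)).trans_eq ?_)
    field_simp
  have hlog0 := Real.log_nonneg (one_lt_Rpar hk hm).le
  refine (nuGT_le_max hk hm N W n).trans (max_le ?_ ?_)
  · have := Real.one_le_rpow hm' hδ.le
    have h4 : 0 ≤ (C * 3 ^ (δ * ε / 8)) ^ 2 * (2 / δ) := by positivity
    nlinarith
  · calc (2 ^ #(W * reprN N n + 1).primeFactors) ^ 2 * Real.log (Rpar k m)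
        ≤ (C * 3 ^ (δ * ε / 8) * (m : ℝ) ^ (δ / 4)) ^ 2 * (2 / δ * (m : ℝ) ^ (δ / 2)) := by
          gcongr
      _ = (C * 3 ^ (δ * ε / 8)) ^ 2 * (2 / δ) * (m : ℝ) ^ δ := by
          have h5 : ((m : ℝ) ^ (δ / 4)) ^ 2 * (m : ℝ) ^ (δ / 2) = (m : ℝ) ^ δ := by
            rw [← Real.rpow_natCast, ← Real.rpow_mul (by positivity), ← Real.rpow_add (by linarith)]
            congr 1
            push_cast
            ring
          rw [← h5]
          ring
      _ ≤ _ := by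
          gcongr
          linarith

lemma Wprim_pos (w : ℕ → ℕ) (N : ℕ) : 0 < Wprim w N :=
  Finset.prod_pos fun _ hp => (mem_filter.1 hp).2.pos

lemma Wprim_le (w : ℕ → ℕ) (N : ℕ) : Wprim w N ≤ 4 ^ w N := by
  exact (le_of_eq (by rw [Wprim, primorial])).trans (primorial_le_four_pow (w N))

lemma Wprim_mul_log_le {w : ℕ → ℕ} {N : ℕ} (hN : 1 < Real.log N)
    (hw : (w N : ℝ) ≤ Real.log (Real.log N) / 2) :
    Wprim w N * (1 + Real.log (Wprim w N)) ≤ 6 * Real.log N ^ (5 / 6 : ℝ) := by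
  set x := Real.log N with hx
  have hW1 : (1 : ℝ) ≤ Wprim w N := by exact_mod_cast Wprim_pos w N
  have hlx := Real.log_pos hN
  have h1 : (Wprim w N : ℝ) ≤ x ^ Real.log 2 := by
    calc (Wprim w N : ℝ) ≤ 4 ^ w N := by exact_mod_cast Wprim_le w N
      _ = Real.exp (w N * Real.log 4) := by
        rw [mul_comm, Real.exp_mul, Real.exp_log (by norm_num), Real.rpow_natCast]
      _ ≤ Real.exp (Real.log x * Real.log 2) := by
        rw [Real.exp_le_exp, show (4 : ℝ) = 2 ^ 2 by norm_num, Real.log_pow]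
        have := Real.log_pos (one_lt_two (α := ℝ))
        push_cast
        nlinarith
      _ = x ^ Real.log 2 := by rw [Real.rpow_def_of_pos (by linarith)]
  have h2 : Real.log (Wprim w N) ≤ 5 * (Wprim w N : ℝ) ^ (1 / 5 : ℝ) := by
    refine (Real.log_le_rpow_div (by linarith) (by norm_num : (0 : ℝ) < 1 / 5)).trans_eq ?_
    ring
  have h3 : 1 ≤ (Wprim w N : ℝ) ^ (1 / 5 : ℝ) := Real.one_le_rpow hW1 (by norm_num)
  calc (Wprim w N : ℝ) * (1 + Real.log (Wprim w N))
      ≤ Wprim w N * (6 * (Wprim w N : ℝ) ^ (1 / 5 : ℝ)) := by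
        gcongr
        linarith
    _ = 6 * (Wprim w N : ℝ) ^ (6 / 5 : ℝ) := by
        rw [show (6 / 5 : ℝ) = 1 + 1 / 5 by norm_num, Real.rpow_add (by linarith), Real.rpow_one]
        ring
    _ ≤ 6 * (x ^ Real.log 2) ^ (6 / 5 : ℝ) := by gcongr
    _ ≤ 6 * x ^ (5 / 6 : ℝ) := by
        rw [← Real.rpow_mul (by linarith)]
        gcongr
        · exact hN.le
        · linarith [Real.log_two_lt_d9]

lemma eventually_mul_rpow_le {b : ℝ} (hb : 0 < b) :
    ∀ᶠ N : ℕ in atTop, 1 < Real.log N ∧ 1 ≤ b * Real.log N ∧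
      6 * Real.log N ^ (5 / 6 : ℝ) ≤ b * Real.log N := by
  have hlim : Tendsto (fun N : ℕ => Real.log N) atTop atTop :=
    Real.tendsto_log_atTop.comp tendsto_natCast_atTop_atTop
  refine hlim.eventually (p := fun x => 1 < x ∧ 1 ≤ b * x ∧ 6 * x ^ (5 / 6 : ℝ) ≤ b * x) ?_
  filter_upwards [eventually_gt_atTop 1, eventually_ge_atTop b⁻¹,
    eventually_ge_atTop ((6 / b) ^ (6 : ℝ))] with x h1 h2 h3
  have hx : 0 < x := by linarith
  refine ⟨h1, ?_, ?_⟩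
  · calc 1 = b * b⁻¹ := (mul_inv_cancel₀ hb.ne').symm
      _ ≤ b * x := by gcongr
  · have h4 := Real.rpow_le_rpow (by positivity) h3 (show (0 : ℝ) ≤ 1 / 6 by norm_num)
    rw [← Real.rpow_mul (by positivity), show (6 : ℝ) * (1 / 6) = 1 by norm_num, Real.rpow_one,
      div_le_iff₀ hb] at h4
    calc 6 * x ^ (5 / 6 : ℝ) ≤ x ^ (1 / 6 : ℝ) * b * x ^ (5 / 6 : ℝ) := by gcongr
      _ = b * x := by
        rw [mul_comm _ b, mul_assoc, ← Real.rpow_add hx]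
        norm_num

lemma avgZ_prod_le_pow {m l : ℕ} [NeZero m] {ν : ZMod m → ℝ} {S : ℝ} (h0 : ∀ x, 0 ≤ ν x)
    (hS : ∀ x, ν x ≤ S) (h : Fin l → ZMod m) : avgZ m (fun x => ∏ i, ν (x + h i)) ≤ S ^ l := by
  have hm0 : (0 : ℝ) < m := by exact_mod_cast NeZero.pos m
  rw [avgZ, div_le_iff₀ hm0]
  refine (Finset.sum_le_card_nsmul _ _ (S ^ l) fun x _ => ?_).trans_eq ?_
  · exact (Finset.prod_le_prod (fun i _ => h0 _) fun i _ => hS _).trans_eq (by simp)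
  · rw [Finset.card_range, nsmul_eq_mul, mul_comm]

lemma avgZ_rpow_le {m e : ℕ} [NeZero m] {τ : ZMod m → ℝ} {c D q B : ℝ} (hc : 0 ≤ c) (hD : 1 ≤ D)
    (hB : τ 0 ^ q ≤ B * m) (hτ : ∀ n, n ≠ 0 → τ n = D * pairWeight c n ^ e) :
    avgZ m (fun n => τ n ^ q) ≤
      B + D ^ ⌈q⌉₊ * (2 ^ (e * ⌈q⌉₊ + 1) * Real.exp ((1 + c) ^ (e * ⌈q⌉₊))) := by
  have hm := NeZero.pos m
  have hm0 : (0 : ℝ) < m := by exact_mod_cast hm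
  have hrange : Finset.range m = insert 0 (Ioo 0 m) := by
    ext x
    simp only [Finset.mem_range, Finset.mem_insert, mem_Ioo]
    omega
  have h1 : ∀ x ∈ Ioo 0 m, τ (x : ZMod m) ^ q ≤
      D ^ ⌈q⌉₊ * pairWeight c (x : ZMod m) ^ (e * ⌈q⌉₊) := by
    intro x hx
    rw [mem_Ioo] at hx
    have hx0 : (x : ZMod m) ≠ 0 := fun h0 => by
      have := ZMod.val_cast_of_lt hx.2
      rw [h0, ZMod.val_zero] at this
      omega
    have h2 : 1 ≤ D * pairWeight c (x : ZMod m) ^ e :=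
      one_le_mul_of_one_le_of_one_le hD (one_le_pow₀ (one_le_pairWeight hc _))
    rw [hτ _ hx0, pow_mul, ← mul_pow, ← Real.rpow_natCast _ ⌈q⌉₊]
    exact Real.rpow_le_rpow_of_exponent_le h2 (Nat.le_ceil q)
  rw [avgZ, div_le_iff₀ hm0, hrange, Finset.sum_insert (by simp), Nat.cast_zero, add_mul]
  refine add_le_add hB ((Finset.sum_le_sum h1).trans ?_)
  rw [← Finset.mul_sum, mul_assoc]
  exact mul_le_mul_of_nonneg_left (sum_pairWeight_pow_le hc _ m) (by positivity)

/-- The family `ν` eventually satisfies the correlation estimate at distinct shifts, with an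
explicit weight. -/
lemma eventually_avgZ_prod_nuGT_le {k : ℕ} (hk : 3 < k) {ε : ℝ} (hε : 0 < ε) {M w : ℕ → ℕ}
    (hM : ∀ N, Nat.Prime (M N)) (hMN : ∀ᶠ N : ℕ in atTop, (N : ℝ) ^ ε < M N ∧ M N ≤ N)
    (hwb : ∀ᶠ N : ℕ in atTop, (w N : ℝ) ≤ Real.log (Real.log N) / 2)
    {l : ℕ} (hl : 1 < l) (hlk : l ≤ 2 ^ (k - 1)) :
    ∀ᶠ N : ℕ in atTop, ((N : ℝ) ^ ε < M N ∧ M N ≤ N ∧ Wprim w N ≤ N) ∧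
      ∀ h : Fin l → ZMod (M N), Function.Injective h →
      avgZ (M N) (fun x => ∏ i, nuGT k N (Wprim w N) (x + h i)) ≤
        ∑ i, ∑ j, if i < j then 2 ^ (l + 2) * (225 ^ l * Real.exp (16 ^ l * (l : ℝ) ^ 2)) *
          pairWeight (16 ^ l * (2 * l)) (h i - h j) ^ #(univ : Finset (Fin l)).offDiag else 0 := by
  have hb : 0 < 1 / ((k : ℝ) * 2 ^ (k + 4)) * ε := by
    have : (0 : ℝ) < k := by exact_mod_cast (by omega : 0 < k)
    positivity
  filter_upwards [hMN, hwb, eventually_mul_rpow_le hb] with N hN hw hlog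
  have hm := (hM N).one_lt
  have : NeZero (M N) := ⟨(hM N).ne_zero⟩
  have hm' : (1 : ℝ) < M N := by exact_mod_cast hm
  have hN0 : (0 : ℝ) < N := by exact_mod_cast (by omega : 0 < N)
  have hRlog : 1 / ((k : ℝ) * 2 ^ (k + 4)) * ε * Real.log N ≤ Real.log (Rpar k (M N)) := by
    rw [log_Rpar hm, mul_assoc, ← Real.log_rpow hN0]
    gcongr
    exact hN.1.le
  have hWL := (Wprim_mul_log_le hlog.1 hw).trans (hlog.2.2.trans hRlog)
  have hWN : Wprim w N ≤ N := by
    have hW1 : (1 : ℝ) ≤ Wprim w N := by exact_mod_cast Wprim_pos w N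
    have h1 : (Wprim w N : ℝ) ≤ Wprim w N * (1 + Real.log (Wprim w N)) :=
      le_mul_of_one_le_right (by linarith) (le_add_of_nonneg_right (Real.log_nonneg hW1))
    have h2 : (Wprim w N : ℝ) ≤ M N := (h1.trans hWL).trans
      ((log_Rpar_le (by omega) hm).trans (Real.log_le_self (by linarith)))
    exact (Nat.cast_le.1 h2).trans hN.2
  exact ⟨⟨hN.1, hN.2, hWN⟩, fun h hh => avgZ_prod_nuGT_le hk hm (Wprim_pos w N)
    (hlog.2.1.trans hRlog) hWL hl (Rpar_pow_le (by omega) hm hlk) hh⟩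

/-- the family `ν` satisfies the `2^{k-1}`-correlation condition. -/
theorem nu_correlation (k : ℕ) (hk : 3 < k)
    (ε : ℝ) (hε : 0 < ε) (M w : ℕ → ℕ)
    (hM : ∀ N, Nat.Prime (M N))
    (hMN : ∀ᶠ N : ℕ in atTop, (N : ℝ) ^ ε < M N ∧ M N ≤ N)
    (hw : Tendsto w atTop atTop)
    (hwb : ∀ᶠ N : ℕ in atTop, (w N : ℝ) ≤ Real.log (Real.log N) / 2) :
    CorrelationCondition M (fun N => fun n : ZMod (M N) => nuGT k N (Wprim w N) n)
      (2 ^ (k - 1)) := by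
  intro l hl hlk
  have hne : ∀ N, NeZero (M N) := fun N => ⟨(hM N).ne_zero⟩
  have hν0 : ∀ N x, 0 ≤ nuGT k N (Wprim w N) (m := M N) x := fun N x =>
    nuGT_nonneg (by omega) (hM N).one_lt _ _ x
  set c : ℝ := 16 ^ l * (2 * l) with hc
  set D : ℝ := 2 ^ (l + 2) * (225 ^ l * Real.exp (16 ^ l * (l : ℝ) ^ 2)) with hD
  set e := #(univ : Finset (Fin l)).offDiag with he
  have hc0 : 0 ≤ c := by positivity
  have hD1 : 1 ≤ D := one_le_mul_of_one_le_of_one_le (one_le_pow₀ (by norm_num))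
    (one_le_mul_of_one_le_of_one_le (one_le_pow₀ (by norm_num)) (Real.one_le_exp (by positivity)))
  set S : ℕ → ℝ := fun N => ⨆ x, nuGT k N (Wprim w N) (m := M N) x with hSdef
  have hS : ∀ N x, nuGT k N (Wprim w N) (m := M N) x ≤ S N := fun N x =>
    le_ciSup (f := fun x => nuGT k N (Wprim w N) (m := M N) x) (Set.finite_range _).bddAbove x
  have hS0 : ∀ N, 0 ≤ S N := fun N => (hν0 N 0).trans (hS N 0)
  set good : ℕ → Prop := fun N => ∀ h : Fin l → ZMod (M N), Function.Injective h →
    avgZ (M N) (fun x => ∏ i, nuGT k N (Wprim w N) (x + h i)) ≤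
      ∑ i, ∑ j, if i < j then D * pairWeight c (h i - h j) ^ e else 0 with hgood
  have hev := eventually_avgZ_prod_nuGT_le hk hε hM hMN hwb hl hlk
  set τ : ∀ N : ℕ, ZMod (M N) → ℝ := fun N n =>
    if good N ∧ n ≠ 0 then D * pairWeight c n ^ e else S N ^ l with hτ
  have hτ0 : ∀ N n, 0 ≤ τ N n := by
    intro N n
    have := one_le_pairWeight hc0 n
    simp only [hτ]
    split_ifs
    · positivity
    · exact pow_nonneg (hS0 N) l
  refine ⟨τ, hτ0, fun q hq => ?_, fun N h => ?_⟩
  · have hl0 : (0 : ℝ) < l := by exact_mod_cast (by omega : 0 < l)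
    obtain ⟨C, hC, hCν⟩ := nuGT_le_rpow (k := k) (by omega) hε (δ := (l * q)⁻¹) (by positivity)
    have hbdd : ∀ᶠ N in atTop, avgZ (M N) (fun n => τ N n ^ q) ≤
        (C ^ l) ^ q + D ^ ⌈q⌉₊ * (2 ^ (e * ⌈q⌉₊ + 1) * Real.exp ((1 + c) ^ (e * ⌈q⌉₊))) := by
      filter_upwards [hev] with N hN
      have := hne N
      refine avgZ_rpow_le hc0 hD1 ?_ fun n hn => if_pos ⟨hN.2, hn⟩
      have h1 : τ N 0 = S N ^ l := if_neg fun h0 => h0.2 rfl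
      have h2 : S N ≤ C * (M N : ℝ) ^ (l * q)⁻¹ :=
        ciSup_le (hCν N _ _ (hM N).one_lt hN.1.2.1 hN.1.1 hN.1.2.2)
      rw [h1]
      calc (S N ^ l) ^ q ≤ ((C * (M N : ℝ) ^ (l * q)⁻¹) ^ l) ^ q := by
            have := hS0 N
            gcongr
        _ = (C ^ l) ^ q * M N := by
            rw [mul_pow, Real.mul_rpow (by positivity) (by positivity), ← Real.rpow_natCast _ l,
              ← Real.rpow_natCast _ l, ← Real.rpow_mul (by positivity), ← Real.rpow_mul
              (x := (M N : ℝ)) (by positivity), ← Real.rpow_mul (by positivity), mul_assoc,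
              inv_mul_cancel₀ (by positivity), Real.rpow_one]
    obtain ⟨C', hC'⟩ := (Filter.isBoundedUnder_of_eventually_le hbdd).bddAbove_range
    exact ⟨C', fun N => hC' ⟨N, rfl⟩⟩
  · have := hne N
    by_cases hgN : good N ∧ Function.Injective h
    · refine (hgN.1 h hgN.2).trans (le_of_eq ?_)
      refine Finset.sum_congr rfl fun i _ => Finset.sum_congr rfl fun j _ => ?_
      split_ifs with hij
      · exact (if_pos ⟨hgN.1, sub_ne_zero.2 fun h0 => hij.ne (hgN.2 h0)⟩).symm
      · rfl
    · have hpair : ∃ i j : Fin l, i < j ∧ τ N (h i - h j) = S N ^ l := by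
        by_cases hg : good N
        · have hni : ¬ Function.Injective h := fun hh => hgN ⟨hg, hh⟩
          rw [Function.not_injective_iff] at hni
          obtain ⟨i, j, hij, hne'⟩ := hni
          rcases lt_or_gt_of_ne hne' with hlt | hlt
          · exact ⟨i, j, hlt, if_neg fun h0 => h0.2 (sub_eq_zero.2 hij)⟩
          · exact ⟨j, i, hlt, if_neg fun h0 => h0.2 (sub_eq_zero.2 hij.symm)⟩
        · exact ⟨⟨0, by omega⟩, ⟨1, hl⟩, by simp, if_neg fun h0 => hg h0.1⟩
      obtain ⟨i, j, hij, hval⟩ := hpair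
      have hterm : ∀ i j : Fin l, 0 ≤ if i < j then τ N (h i - h j) else 0 := by
        intro i j
        split_ifs
        · exact hτ0 N _
        · exact le_rfl
      calc _ ≤ S N ^ l := avgZ_prod_le_pow (hν0 N) (hS N) h
        _ = if i < j then τ N (h i - h j) else 0 := by rw [if_pos hij, hval]
        _ ≤ ∑ j, if i < j then τ N (h i - h j) else 0 :=
          Finset.single_le_sum (f := fun j => if i < j then τ N (h i - h j) else 0)
            (fun j _ => hterm i j) (Finset.mem_univ j)
        _ ≤ _ := Finset.single_le_sum (f := fun i => ∑ j, if i < j then τ N (h i - h j) else 0)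
            (fun i _ => Finset.sum_nonneg fun j _ => hterm i j) (Finset.mem_univ i)

end
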